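/- arXiv:2511.04103 — 10 statements merged into one kernel-verified Lean document; each statement's English description precedes it below -/
import Mathlib

section
/- Let U be a countable set, let C : ℕ → Set U be a language collection with every C i nonempty, and let k ≥ 1. Then C is k-list identifiable in the limit if and only if C satisfies the k-Angluin condition. -/
/-- `x : ℕ → U` is an enumeration of the language `L ⊆ U`. -/
def IsEnumeration {U : Type*} (L : Set U) (x : ℕ → U) : Prop :=
  (∀ n, x n ∈ L) ∧ ∀ u ∈ L, ∃ n, x n = u

/-- The finite sequence consisting of the first `t` values of `x`. -/
def prefixList {U : Type*} (x : ℕ → U) (t : ℕ) : List U :=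
  List.ofFn (fun j : Fin t => x j)

/-- `A` is a `k`-list identifier that identifies the collection `C` in the limit. -/
def IdentifiesInLimit {U : Type*} (C : ℕ → Set U) (k : ℕ) (A : List U → Finset ℕ) : Prop :=
  (∀ s, (A s).card ≤ k) ∧
  ∀ z : ℕ, ∀ x : ℕ → U, IsEnumeration (C z) x →
    ∃ tStar : ℕ, ∀ t ≥ tStar, ∃ i ∈ A (prefixList x t), C i = C z

/-- The collection `C` is `k`-list identifiable in the limit. -/
def ListIdentifiable {U : Type*} (C : ℕ → Set U) (k : ℕ) : Prop :=
  ∃ A : List U → Finset ℕ, IdentifiesInLimit C k A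

/-- The recursive Angluin predicates `Ψ_k`. -/
def Psi {U : Type*} (C : ℕ → Set U) : ℕ → Set U → Prop
  | 0, _ => True
  | 1, L => ∃ T : Finset U, (T : Set U) ⊆ L ∧
      ∀ j : ℕ, C j ⊂ L → ¬((T : Set U) ⊆ C j)
  | (k + 2), L => ∃ T : Finset U, (T : Set U) ⊆ L ∧
      ∀ j : ℕ, C j ⊂ L → ¬((T : Set U) ⊆ C j) ∨ Psi C (k + 1) (C j)

/-- The collection `C` satisfies the `k`-Angluin condition. -/
def AngluinCondition {U : Type*} (C : ℕ → Set U) (k : ℕ) : Prop :=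
  ∀ i : ℕ, Psi C k (C i)

/-- The predicates `Psi`, reindexed so that the recursion starts from the always false predicate. -/
def AngluinRank {U : Type*} (C : ℕ → Set U) : ℕ → Set U → Prop
  | 0, _ => False
  | k + 1, L => ∃ T : Finset U, (T : Set U) ⊆ L ∧
      ∀ j : ℕ, C j ⊂ L → (T : Set U) ⊆ C j → AngluinRank C k (C j)

theorem psi_succ_iff_angluinRank {U : Type*} (C : ℕ → Set U) (k : ℕ) (L : Set U) :
    Psi C (k + 1) L ↔ AngluinRank C (k + 1) L := by
  induction k generalizing L with
  | zero => simp [Psi, AngluinRank]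
  | succ k ih =>
    rw [Psi, AngluinRank]
    simp only [ih, ← imp_iff_not_or]

theorem mem_prefixList {U : Type*} {x : ℕ → U} {t : ℕ} {u : U} :
    u ∈ prefixList x t ↔ ∃ n < t, x n = u := by
  simp only [prefixList, List.mem_ofFn]
  exact ⟨fun ⟨n, h⟩ => ⟨n, n.2, h⟩, fun ⟨n, hn, h⟩ => ⟨⟨n, hn⟩, h⟩⟩

/-- Strictly growing finite sequences are prefixes of a common infinite sequence. -/
theorem exists_prefixList_eq {U : Type*} (s : ℕ → List U) (e : ℕ → U)
    (hs : ∀ n, s n ++ [e n] <+: s (n + 1)) :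
    ∃ x : ℕ → U, ∀ n, prefixList x (s n).length = s n := by
  have hlen : ∀ n, n ≤ (s n).length := by
    intro n
    induction n with
    | zero => simp
    | succ n ih =>
      have := (hs n).length_le
      simp only [List.length_append, List.length_singleton] at this
      omega
  have hmono : ∀ m n, m ≤ n → s m <+: s n := by
    intro m n hmn
    induction n, hmn using Nat.le_induction with
    | base => exact List.prefix_rfl
    | succ n _ ih => exact ih.trans ((List.prefix_append _ _).trans (hs n))
  refine ⟨fun n => (s (n + 1))[n]'(hlen (n + 1)), fun n => ?_⟩
  refine List.ext_getElem (by simp [prefixList]) fun m h₁ h₂ => ?_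
  simp only [prefixList, List.getElem_ofFn]
  rcases le_total (m + 1) n with h | h
  · exact (hmono _ _ h).getElem _
  · exact ((hmono _ _ h).getElem _).symm

/-- Every finite sequence in `C z` extends to a locking sequence of the identifier for `C z`. -/
theorem IdentifiesInLimit.exists_locking {U : Type*} [Countable U] {C : ℕ → Set U} {k : ℕ}
    {A : List U → Finset ℕ} (hA : IdentifiesInLimit C k A) {z : ℕ} (hz : (C z).Nonempty)
    (σ : List U) (hσ : ∀ u ∈ σ, u ∈ C z) :
    ∃ τ : List U, (∀ u ∈ τ, u ∈ C z) ∧ σ <+: τ ∧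
      ∀ τ' : List U, τ <+: τ' → (∀ u ∈ τ', u ∈ C z) → ∃ i ∈ A τ', C i = C z := by
  by_contra! hcon
  obtain ⟨e, he⟩ := (Set.to_countable (C z)).exists_eq_range hz
  have he_mem : ∀ n, e n ∈ C z := fun n => he ▸ Set.mem_range_self n
  have hnext : ∀ (τ : {τ : List U // (∀ u ∈ τ, u ∈ C z) ∧ σ <+: τ}) (n : ℕ),
      ∃ τ' : {τ : List U // (∀ u ∈ τ, u ∈ C z) ∧ σ <+: τ},
        τ.1 ++ [e n] <+: τ'.1 ∧ ∀ i ∈ A τ'.1, C i ≠ C z := by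
    rintro ⟨τ, hτ, hστ⟩ n
    have hmem : ∀ u ∈ τ ++ [e n], u ∈ C z := by
      intro u hu
      rcases List.mem_append.1 hu with h | h
      · exact hτ u h
      · rw [List.mem_singleton.1 h]
        exact he_mem n
    have hpre : σ <+: τ ++ [e n] := hστ.trans (List.prefix_append _ _)
    obtain ⟨τ', h₁, h₂, h₃⟩ := hcon _ hmem hpre
    exact ⟨⟨τ', h₂, hpre.trans h₁⟩, h₁, h₃⟩
  choose next hpre hbad using hnext
  let s : ℕ → {τ : List U // (∀ u ∈ τ, u ∈ C z) ∧ σ <+: τ} :=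
    fun n => Nat.rec ⟨σ, hσ, List.prefix_rfl⟩ (fun n τ => next τ n) n
  have hs : ∀ n, (s n).1 ++ [e n] <+: (s (n + 1)).1 := fun n => hpre (s n) n
  have hlen : ∀ n, n ≤ (s n).1.length := by
    intro n
    induction n with
    | zero => simp
    | succ n ih =>
      have := (hs n).length_le
      simp only [List.length_append, List.length_singleton] at this
      omega
  obtain ⟨x, hx⟩ := exists_prefixList_eq (fun n => (s n).1) e hs
  have hxe : IsEnumeration (C z) x := by
    refine ⟨fun n => (s (n + 1)).2.1 _ ?_, fun u hu => ?_⟩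
    · rw [← hx (n + 1), mem_prefixList]
      exact ⟨n, hlen (n + 1), rfl⟩
    · rw [he] at hu
      obtain ⟨n, rfl⟩ := hu
      have : e n ∈ (s (n + 1)).1 := (hs n).subset (by simp)
      rw [← hx (n + 1), mem_prefixList] at this
      obtain ⟨m, -, hm⟩ := this
      exact ⟨m, hm⟩
  obtain ⟨t, ht⟩ := hA.2 z x hxe
  obtain ⟨i, hi, hiz⟩ := ht (s (t + 1)).1.length ((Nat.le_succ t).trans (hlen (t + 1)))
  rw [hx (t + 1)] at hi
  exact hbad (s t) t i hi hiz

/-- If `C z` violates the rank-`m` condition, the identifier can be forced to list `m + 1`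
indices of sublanguages of `C z`. -/
theorem IdentifiesInLimit.exists_large_output {U : Type*} [Countable U] {C : ℕ → Set U} {k : ℕ}
    {A : List U → Finset ℕ} (hA : IdentifiesInLimit C k A) (hC : ∀ i, (C i).Nonempty)
    (m z : ℕ) (hz : ¬ AngluinRank C m (C z)) (σ : List U) (hσ : ∀ u ∈ σ, u ∈ C z) :
    ∃ τ : List U, σ <+: τ ∧ (∀ u ∈ τ, u ∈ C z) ∧
      ∃ F ⊆ A τ, F.card = m + 1 ∧ ∀ i ∈ F, C i ⊆ C z := by
  classical
  induction m generalizing z σ with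
  | zero =>
    obtain ⟨τ, hτ, hστ, hlock⟩ := hA.exists_locking (hC z) σ hσ
    obtain ⟨i, hi, hiz⟩ := hlock τ List.prefix_rfl hτ
    exact ⟨τ, hστ, hτ, {i}, by simpa using hi, by simp, by simp [hiz]⟩
  | succ m ih =>
    obtain ⟨τ, hτ, hστ, hlock⟩ := hA.exists_locking (hC z) σ hσ
    rw [AngluinRank] at hz
    push Not at hz
    obtain ⟨j, hj, hτj, hjm⟩ := hz τ.toFinset fun u hu => hτ u (by simpa using hu)
    obtain ⟨ρ, hτρ, hρ, F, hF, hcard, hFj⟩ := ih j hjm τ fun u hu => hτj (by simpa using hu)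
    have hρz : ∀ u ∈ ρ, u ∈ C z := fun u hu => hj.subset (hρ u hu)
    obtain ⟨i, hi, hiz⟩ := hlock ρ hτρ hρz
    have hiF : i ∉ F := fun h => hj.not_subset (hiz ▸ hFj i h)
    refine ⟨ρ, hστ.trans hτρ, hρz, insert i F, Finset.insert_subset hi hF, ?_, ?_⟩
    · rw [Finset.card_insert_of_notMem hiF, hcard]
    · intro l hl
      rcases Finset.mem_insert.1 hl with rfl | h
      · exact hiz.subset
      · exact (hFj l h).trans hj.subset

theorem ListIdentifiable.angluinRank {U : Type*} [Countable U] {C : ℕ → Set U} {k : ℕ}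
    (h : ListIdentifiable C k) (hC : ∀ i, (C i).Nonempty) (z : ℕ) : AngluinRank C k (C z) := by
  obtain ⟨A, hA⟩ := h
  by_contra hz
  obtain ⟨τ, -, -, F, hF, hcard, -⟩ := hA.exists_large_output hC k z hz [] (by simp)
  have := (Finset.card_le_card hF).trans (hA.1 τ)
  omega

theorem IsEnumeration.eventually_subset_prefixList {U : Type*} {L : Set U} {x : ℕ → U}
    (hx : IsEnumeration L x) (T : Finset U) (hT : (T : Set U) ⊆ L) :
    ∀ᶠ t in Filter.atTop, ∀ u ∈ T, u ∈ prefixList x t := by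
  rw [Filter.eventually_all_finset]
  intro u hu
  obtain ⟨n, hn⟩ := hx.2 u (hT hu)
  filter_upwards [Filter.eventually_gt_atTop n] with t ht
  exact mem_prefixList.2 ⟨n, ht, hn⟩

theorem listIdentifiable_of_angluinRank {U : Type*} {C : ℕ → Set U} {k : ℕ}
    (h : ∀ z, AngluinRank C k (C z)) : ListIdentifiable C k := by
  classical
  have htell : ∀ m i, AngluinRank C (m + 1) (C i) → ∃ T : Finset U, (T : Set U) ⊆ C i ∧
      ∀ j : ℕ, C j ⊂ C i → (T : Set U) ⊆ C j → AngluinRank C m (C j) := fun _ _ hi => hi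
  choose T hTsub hT using htell
  let good (m : ℕ) (s : List U) : Set ℕ :=
    {i | ∃ hi : AngluinRank C (m + 1) (C i), (∀ u ∈ T m i hi, u ∈ s) ∧ ∀ u ∈ s, u ∈ C i}
  refine ⟨fun s => (Finset.range k).image fun m => sInf (good m s),
    fun s => Finset.card_image_le.trans_eq (Finset.card_range k), fun z x hx => ?_⟩
  obtain ⟨m, hmk, hm, hm'⟩ : ∃ m < k, ¬ AngluinRank C m (C z) ∧ AngluinRank C (m + 1) (C z) := by
    by_contra! hcon
    have : ∀ m ≤ k, ¬ AngluinRank C m (C z) := by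
      intro m hmk
      induction m with
      | zero => exact id
      | succ m ih => exact hcon m hmk (ih (Nat.le_of_succ_le hmk))
    exact this k le_rfl (h z)
  have hmem : ∀ t, ∀ u ∈ prefixList x t, u ∈ C z := by
    intro t u hu
    obtain ⟨n, -, rfl⟩ := mem_prefixList.1 hu
    exact hx.1 n
  have hgood : ∀ᶠ t in Filter.atTop, z ∈ good m (prefixList x t) := by
    filter_upwards [hx.eventually_subset_prefixList _ (hTsub m z hm')] with t ht
    exact ⟨hm', ht, hmem t⟩
  have hbad : ∀ᶠ t in Filter.atTop, ∀ i ∈ Finset.range (z + 1),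
      i ∈ good m (prefixList x t) → C i = C z := by
    rw [Filter.eventually_all_finset]
    intro i _
    by_cases hsub : C z ⊆ C i
    · refine Filter.Eventually.of_forall fun t ⟨hi, hTi, _⟩ => ?_
      by_contra hne
      exact hm (hT m i hi z (hsub.ssubset_of_ne (Ne.symm hne)) fun u hu => hmem t u (hTi u hu))
    · obtain ⟨u, huz, hui⟩ := Set.not_subset.1 hsub
      filter_upwards [hx.eventually_subset_prefixList {u} (by simpa using huz)] with t ht
      rintro ⟨_, _, hi⟩
      exact absurd (hi u (ht u (by simp))) hui
  obtain ⟨t₀, ht₀⟩ := Filter.eventually_atTop.1 (hgood.and hbad)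
  refine ⟨t₀, fun t ht => ⟨sInf (good m (prefixList x t)),
    Finset.mem_image_of_mem _ (Finset.mem_range.2 hmk), ?_⟩⟩
  obtain ⟨hzt, hit⟩ := ht₀ t ht
  exact hit _ (Finset.mem_range_succ_iff.2 (Nat.sInf_le hzt)) (Nat.sInf_mem ⟨z, hzt⟩)

/-- A countable language collection is `k`-list identifiable in the limit
if and only if it satisfies the `k`-Angluin condition. -/
theorem list_identifiable_iff_angluin {U : Type*} [Countable U]
    (C : ℕ → Set U) (hC : ∀ i, (C i).Nonempty) (k : ℕ) (hk : 1 ≤ k) :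
    ListIdentifiable C k ↔ AngluinCondition C k := by
  obtain ⟨k, rfl⟩ := Nat.exists_eq_succ_of_ne_zero (Nat.one_le_iff_ne_zero.1 hk)
  simp only [AngluinCondition, Nat.succ_eq_add_one, psi_succ_iff_angluinRank]
  exact ⟨fun h => h.angluinRank hC, listIdentifiable_of_angluinRank⟩
end

section
/- Let U be a countable set, let C : ℕ → Set U be a language collection with every C i nonempty, and let k ≥ 1. Then C is k-list identifiable in the limit if and only if there is a cover ℕ = J_1 ∪ … ∪ J_k of the index set such that for each m ∈ {1,…,k} the subcollection of C indexed by J_m is identifiable in the limit with a single guess; that is, there exists a function A_m from finite sequences over U to indices in J_m such that for every z ∈ J_m and every enumeration x of C z, there exists t* with C(A_m(x 1, …, x t)) = C z for all t ≥ t*. -/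
/-- `Am` is a single-guess identifier for the subcollection of `C` indexed by `J`:
its guesses always lie in `J`, and on every enumeration of a language `C z` with `z ∈ J`
its guesses are eventually languages equal to `C z`. -/
def SingleIdentifiesSub {U : Type*} (C : ℕ → Set U) (J : Set ℕ) (Am : List U → ℕ) : Prop :=
  (∀ s, Am s ∈ J) ∧
  ∀ z ∈ J, ∀ x : ℕ → U, IsEnumeration (C z) x →
    ∃ tStar : ℕ, ∀ t ≥ tStar, C (Am (prefixList x t)) = C z

/-- The indices in `C` of proper sublanguages of `C z` that contain `T`. -/
def sublanguagesAbove {U : Type*} (C : ℕ → Set U) (z : ℕ) (T : Finset U) : Set ℕ :=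
  {i | (T : Set U) ⊆ C i ∧ C i ⊂ C z}

/-- The iterated tell-tale condition of depth `k`: every `C z` with `z ∈ S` has a finite subset `T`
such that the members of `S` that lie strictly between satisfy the condition of depth `k - 1`. -/
def HasTellTales {U : Type*} (C : ℕ → Set U) : ℕ → Set ℕ → Prop
  | 0, S => S = ∅
  | k + 1, S => ∀ z ∈ S, ∃ T : Finset U, (T : Set U) ⊆ C z ∧
      HasTellTales C k (S ∩ sublanguagesAbove C z T)

lemma sublanguagesAbove_anti {U : Type*} (C : ℕ → Set U) (z : ℕ) {T T' : Finset U} (h : T ⊆ T') :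
    sublanguagesAbove C z T' ⊆ sublanguagesAbove C z T :=
  fun _ hi => ⟨(Finset.coe_subset.2 h).trans hi.1, hi.2⟩

lemma HasTellTales.mono {U : Type*} {C : ℕ → Set U} {k : ℕ} {S S' : Set ℕ}
    (hS : HasTellTales C k S) (h : S' ⊆ S) : HasTellTales C k S' := by
  induction k generalizing S S' with
  | zero => exact Set.subset_eq_empty h hS
  | succ k ih =>
    intro z hz
    obtain ⟨T, hT, hk⟩ := hS z (h hz)
    exact ⟨T, hT, ih hk (Set.inter_subset_inter_left _ h)⟩

/-- A sequence of finite sequences, each extending the previous one by at least one term,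
has a limit of which all of them are prefixes. -/
lemma exists_limit_of_extending {U : Type*} (σ : ℕ → List U) (hpre : ∀ n, σ n <+: σ (n + 1))
    (hlen : ∀ n, (σ n).length < (σ (n + 1)).length) :
    ∃ x : ℕ → U, ∀ n, ∀ l, l <+: σ n → prefixList x l.length = l := by
  have hlen' : ∀ n, n ≤ (σ n).length := fun _ => (strictMono_nat_of_lt_succ hlen).le_apply
  have hmono : ∀ m n, m ≤ n → σ m <+: σ n := by
    intro m n h
    induction n, h using Nat.le_induction with
    | base => exact List.prefix_rfl
    | succ n _ ih => exact ih.trans (hpre n)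
  refine ⟨fun i => (σ (i + 1))[i]'(hlen' (i + 1)), fun n l hl => ?_⟩
  refine List.ext_getElem (by simp [prefixList]) fun i h₁ h₂ => ?_
  simp only [prefixList, List.getElem_ofFn]
  have hi := hlen' (i + 1)
  rw [hl.getElem h₂]
  rcases le_total (i + 1) n with h | h
  · exact (hmono _ _ h).getElem _
  · exact ((hmono _ _ h).getElem _).symm

lemma exists_isEnumeration {U : Type*} [Countable U] {L : Set U} (hL : L.Nonempty) :
    ∃ x, IsEnumeration L x := by
  obtain ⟨e, he⟩ := (Set.to_countable L).exists_eq_range hL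
  exact ⟨e, fun n => he ▸ Set.mem_range_self n, fun u hu => by rwa [he] at hu⟩

/-- If `P` eventually holds along every enumeration of `L`, then `L` has a locking sequence
for `P`. -/
lemma exists_locking_sequence {U : Type*} [Countable U] {L : Set U} (hL : L.Nonempty)
    (P : List U → Prop)
    (hP : ∀ x, IsEnumeration L x → ∃ t₀, ∀ t ≥ t₀, P (prefixList x t)) :
    ∃ σ : List U, (∀ u ∈ σ, u ∈ L) ∧ ∀ τ : List U, (∀ u ∈ τ, u ∈ L) → P (σ ++ τ) := by
  by_contra! hcon
  obtain ⟨e, heL, he⟩ := exists_isEnumeration hL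
  have hext : ∀ s : {s : List U // ∀ u ∈ s, u ∈ L}, ∃ τ : List U, (∀ u ∈ τ, u ∈ L) ∧
      ¬ P (s.1 ++ τ) := fun s => hcon s.1 s.2
  choose τ hτ hbad using hext
  let σ : ℕ → {s : List U // ∀ u ∈ s, u ∈ L} := fun n =>
    Nat.rec ⟨[], by simp⟩ (fun n s => ⟨s.1 ++ τ s ++ [e n], by
      intro u hu
      simp only [List.mem_append, List.mem_singleton] at hu
      rcases hu with (h | h) | h
      · exact s.2 u h
      · exact hτ s u h
      · exact h ▸ heL n⟩) n
  have hσ : ∀ n, (σ (n + 1)).1 = (σ n).1 ++ τ (σ n) ++ [e n] := fun n => rfl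
  obtain ⟨x, hx⟩ := exists_limit_of_extending (fun n => (σ n).1)
    (fun n => by simp [hσ]) (fun n => by simp [hσ])
  have hσlen : ∀ n, n ≤ (σ n).1.length := fun _ =>
    (strictMono_nat_of_lt_succ (f := fun n => (σ n).1.length) fun n => by simp [hσ]).le_apply
  have hmem : ∀ n, ∀ u ∈ (σ n).1, ∃ i, x i = u := by
    intro n u hu
    rw [← hx n _ List.prefix_rfl] at hu
    obtain ⟨i, hi⟩ := List.mem_ofFn.1 hu
    exact ⟨i, hi⟩
  have hxL : IsEnumeration L x := by
    refine ⟨fun n => ?_, fun u hu => ?_⟩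
    · apply (σ (n + 1)).2
      rw [← hx (n + 1) _ List.prefix_rfl]
      exact List.mem_ofFn.2 ⟨⟨n, hσlen (n + 1)⟩, rfl⟩
    · obtain ⟨n, rfl⟩ := he u hu
      exact hmem (n + 1) _ (by simp [hσ])
  obtain ⟨t₀, ht₀⟩ := hP x hxL
  apply hbad (σ t₀)
  rw [← hx (t₀ + 1) ((σ t₀).1 ++ τ (σ t₀)) (by simp [hσ])]
  exact ht₀ _ ((hσlen t₀).trans (by simp))

/-- Prepending finitely many elements of `L` to an enumeration of `L`. -/
lemma IsEnumeration.exists_append {U : Type*} {L : Set U} {x : ℕ → U} (hx : IsEnumeration L x)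
    (σ : List U) (hσ : ∀ u ∈ σ, u ∈ L) :
    ∃ y, IsEnumeration L y ∧ ∀ t, prefixList y (σ.length + t) = σ ++ prefixList x t := by
  refine ⟨fun n => if h : n < σ.length then σ[n] else x (n - σ.length), ⟨fun n => ?_, ?_⟩, ?_⟩
  · dsimp only
    split_ifs with h
    · exact hσ _ (List.getElem_mem h)
    · exact hx.1 _
  · intro u hu
    obtain ⟨n, rfl⟩ := hx.2 u hu
    exact ⟨σ.length + n, by simp⟩
  · intro t
    refine List.ext_getElem (by simp [prefixList]) fun i h₁ h₂ => ?_
    simp [prefixList, List.getElem_append]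

lemma mem_of_mem_prefixList {U : Type*} {L : Set U} {x : ℕ → U} (hx : IsEnumeration L x) {t : ℕ}
    {u : U} (hu : u ∈ prefixList x t) : u ∈ L := by
  obtain ⟨i, rfl⟩ := List.mem_ofFn.1 hu
  exact hx.1 _

/-- List identifiability yields iterated tell-tales. -/
lemma hasTellTales_of_list_identifier {U : Type*} [Countable U] (C : ℕ → Set U)
    (hC : ∀ i, (C i).Nonempty) (k : ℕ) (S : Set ℕ) (A : List U → Finset ℕ)
    (hcard : ∀ s, (A s).card ≤ k)
    (hA : ∀ z ∈ S, ∀ x, IsEnumeration (C z) x →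
      ∃ t₀, ∀ t ≥ t₀, ∃ i ∈ A (prefixList x t), C i = C z) :
    HasTellTales C k S := by
  classical
  induction k generalizing S A with
  | zero =>
    refine Set.eq_empty_of_forall_notMem fun z hz => ?_
    obtain ⟨x, hx⟩ := exists_isEnumeration (hC z)
    obtain ⟨t₀, ht₀⟩ := hA z hz x hx
    obtain ⟨i, hi, -⟩ := ht₀ t₀ le_rfl
    have := Finset.card_eq_zero.1 (Nat.le_zero.1 (hcard (prefixList x t₀)))
    simp [this] at hi
  | succ k ih =>
    intro z hz
    obtain ⟨σ, hσ, hlock⟩ := exists_locking_sequence (hC z)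
      (fun s => ∃ i ∈ A s, C i = C z) (hA z hz)
    refine ⟨σ.toFinset, fun u hu => hσ u (by simpa using hu), ?_⟩
    refine ih _ (fun s => if ∀ u ∈ s, u ∈ C z then {i ∈ A (σ ++ s) | C i ≠ C z} else ∅) ?_ ?_
    · intro s
      split_ifs with hs
      · obtain ⟨i, hi, hiz⟩ := hlock s hs
        have : ({i ∈ A (σ ++ s) | C i ≠ C z}).card < (A (σ ++ s)).card :=
          Finset.card_lt_card (Finset.filter_ssubset.2 ⟨i, hi, by simpa using hiz⟩)
        have := hcard (σ ++ s)
        omega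
      · simp
    · rintro w ⟨hwS, hσw, hwz⟩ x hx
      obtain ⟨y, hy, hyx⟩ := hx.exists_append σ fun u hu => hσw (by simpa using hu)
      obtain ⟨t₀, ht₀⟩ := hA w hwS y hy
      refine ⟨t₀, fun t ht => ?_⟩
      obtain ⟨i, hi, hiw⟩ := ht₀ (σ.length + t) (by omega)
      rw [hyx] at hi
      refine ⟨i, ?_, hiw⟩
      rw [if_pos fun u hu => hwz.subset (mem_of_mem_prefixList hx hu)]
      exact Finset.mem_filter.2 ⟨hi, hiw ▸ hwz.ne⟩

/-- Tell-tales of depth one suffice for identification with a single guess. -/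
lemma exists_singleIdentifiesSub {U : Type*} (C : ℕ → Set U) (J : Set ℕ) (hJ : J.Nonempty)
    (T : ℕ → Finset U) (hT : ∀ j ∈ J, (T j : Set U) ⊆ C j)
    (hTJ : ∀ j ∈ J, ∀ i ∈ J, i ∉ sublanguagesAbove C j (T j)) :
    ∃ Am, SingleIdentifiesSub C J Am := by
  classical
  obtain ⟨j₀, hj₀⟩ := hJ
  let Q : List U → ℕ → Prop := fun s i => i ∈ J ∧ (∀ u ∈ T i, u ∈ s) ∧ ∀ u ∈ s, u ∈ C i
  refine ⟨fun s => if h : ∃ i, Q s i then Nat.find h else j₀, fun s => ?_, fun z hz x hx => ?_⟩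
  · dsimp only
    split_ifs with h
    · exact (Nat.find_spec h).1
    · exact hj₀
  have hG : ∃ i, i ∈ J ∧ (T i : Set U) ⊆ C z ∧ C z ⊆ C i := ⟨z, hz, hT z hz, subset_rfl⟩
  obtain ⟨hnJ, hnT, hnC⟩ := Nat.find_spec hG
  set n := Nat.find hG
  have heq : C n = C z := by
    by_contra hne
    exact hTJ n hnJ z hz ⟨hnT, hnC.ssubset_of_ne (Ne.symm hne)⟩
  have hseen : ∀ u ∈ C z, ∀ᶠ t in Filter.atTop, u ∈ prefixList x t := by
    intro u hu
    obtain ⟨m, rfl⟩ := hx.2 u hu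
    filter_upwards [Filter.eventually_gt_atTop m] with t ht
    exact List.mem_ofFn.2 ⟨⟨m, ht⟩, rfl⟩
  have h₁ : ∀ᶠ t in Filter.atTop, ∀ u ∈ T n, u ∈ prefixList x t :=
    (Filter.eventually_all_finset _).2 fun u hu => hseen u (hnT hu)
  have h₂ : ∀ᶠ t in Filter.atTop, ∀ i ∈ Finset.range n, ¬ Q (prefixList x t) i := by
    refine (Filter.eventually_all_finset _).2 fun i hi => ?_
    have hmin := Nat.find_min hG (Finset.mem_range.1 hi)
    by_cases hiC : C z ⊆ C i
    · refine Filter.Eventually.of_forall fun t hQ => hmin ⟨hQ.1, fun u hu => ?_, hiC⟩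
      exact mem_of_mem_prefixList hx (hQ.2.1 u hu)
    · obtain ⟨u, huz, hui⟩ := Set.not_subset.1 hiC
      filter_upwards [hseen u huz] with t ht hQ
      exact hui (hQ.2.2 u ht)
  obtain ⟨t₀, ht₀⟩ := Filter.eventually_atTop.1 (h₁.and h₂)
  refine ⟨t₀, fun t ht => ?_⟩
  obtain ⟨hTn, hlt⟩ := ht₀ t ht
  have hQn : Q (prefixList x t) n :=
    ⟨hnJ, hTn, fun u hu => hnC (mem_of_mem_prefixList hx hu)⟩
  have hex : ∃ i, Q (prefixList x t) i := ⟨n, hQn⟩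
  dsimp only
  rw [dif_pos hex, (Nat.find_eq_iff hex).2 ⟨hQn, fun i hi => hlt i (Finset.mem_range.2 hi)⟩, heq]

/-- A finite part of `C n` that is contained in no `C m ⊂ C n` with `m < n`. -/
lemma exists_finset_separating {U : Type*} (C : ℕ → Set U) (n : ℕ) :
    ∃ F : Finset U, (F : Set U) ⊆ C n ∧ ∀ m < n, m ∉ sublanguagesAbove C n F := by
  classical
  have h : ∀ m, ∃ F : Finset U, (F : Set U) ⊆ C n ∧ m ∉ sublanguagesAbove C n F := by
    intro m
    by_cases hm : C m ⊂ C n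
    · obtain ⟨u, hu, hum⟩ := Set.exists_of_ssubset hm
      exact ⟨{u}, by simpa using hu, fun h => hum (h.1 (by simp))⟩
    · exact ⟨∅, by simp, fun h => hm h.2⟩
  choose F hF hFm using h
  refine ⟨(Finset.range n).biUnion F, by simpa using fun i _ => hF i, fun m hm hmem => ?_⟩
  exact hFm m (sublanguagesAbove_anti C n
    (Finset.subset_biUnion_of_mem F (Finset.mem_range.2 hm)) hmem)

/-- A finite subset of `C n` with a colour below `k` that bounds the depth of tell-tales
still needed below `C n`. -/
def ColoredTellTale {U : Type*} (C : ℕ → Set U) (k n : ℕ) : Type _ :=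
  {p : Finset U × ℕ // p.2 < k ∧ (p.1 : Set U) ⊆ C n ∧
    HasTellTales C p.2 (sublanguagesAbove C n p.1)}

lemma exists_coloredTellTale {U : Type*} (C : ℕ → Set U) {k : ℕ} (hk : 1 ≤ k)
    (hAng : HasTellTales C k Set.univ) (n : ℕ) (g : ∀ m < n, ColoredTellTale C k m) :
    ∃ a : ColoredTellTale C k n,
      (∀ m h, n ∈ sublanguagesAbove C m (g m h).1.1 → a.1.2 < (g m h).1.2) ∧
      ∀ m < n, m ∉ sublanguagesAbove C n a.1.1 := by
  classical
  obtain ⟨F, hF, hFn⟩ := exists_finset_separating C n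
  suffices h : ∃ T : Finset U, ∃ r, r < k ∧ (T : Set U) ⊆ C n ∧
      HasTellTales C r (sublanguagesAbove C n T) ∧
      ∀ m h, n ∈ sublanguagesAbove C m (g m h).1.1 → r < (g m h).1.2 by
    obtain ⟨T, r, hr, hT, hAr, hlt⟩ := h
    refine ⟨⟨(T ∪ F, r), hr, by simp [hT, hF], hAr.mono
      (sublanguagesAbove_anti C n Finset.subset_union_left)⟩, hlt, fun m hm hmem => ?_⟩
    exact hFn m hm (sublanguagesAbove_anti C n Finset.subset_union_right hmem)
  by_cases hp : ∃ r m, ∃ h : m < n, n ∈ sublanguagesAbove C m (g m h).1.1 ∧ (g m h).1.2 = r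
  · obtain ⟨m, hm, hnm, hr⟩ := Nat.find_spec hp
    have hmin : ∀ m' h', n ∈ sublanguagesAbove C m' (g m' h').1.1 →
        (g m hm).1.2 ≤ (g m' h').1.2 := fun m' h' hn' =>
      hr ▸ Nat.find_min' hp ⟨m', h', hn', rfl⟩
    obtain ⟨hlt, -, hAm⟩ := (g m hm).2
    generalize (g m hm).1.2 = q at hmin hlt hAm
    cases q with
    | zero => exact absurd hnm (by rw [show sublanguagesAbove C m (g m hm).1.1 = ∅ from hAm]; simp)
    | succ r =>
      obtain ⟨T, hT, hAr⟩ := hAm n hnm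
      refine ⟨T ∪ (g m hm).1.1, r, by omega, ?_, hAr.mono ?_,
        fun m' h' hn' => hmin m' h' hn'⟩
      · simpa [hT] using hnm.1
      · intro i hi
        exact ⟨⟨(sublanguagesAbove_anti C n Finset.subset_union_right hi).1, hi.2.trans hnm.2⟩,
          sublanguagesAbove_anti C n Finset.subset_union_left hi⟩
  · obtain ⟨r, rfl⟩ := Nat.exists_eq_add_of_le' hk
    obtain ⟨T, hT, hAr⟩ := hAng n (Set.mem_univ n)
    refine ⟨T, r, by omega, hT, by simpa using hAr, fun m h hn => ?_⟩
    exact absurd ⟨_, m, h, hn, rfl⟩ hp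

/-- Iterated tell-tales of depth `k` allow a colouring of the indices by `k` colours, each of
which has tell-tales of depth one. -/
lemma exists_coloring {U : Type*} (C : ℕ → Set U) {k : ℕ} (hk : 1 ≤ k)
    (hAng : HasTellTales C k Set.univ) :
    ∃ (T : ℕ → Finset U) (c : ℕ → ℕ), (∀ n, c n < k) ∧ (∀ n, (T n : Set U) ⊆ C n) ∧
      ∀ i j, c i = c j → i ∉ sublanguagesAbove C j (T j) := by
  choose G hG₁ hG₂ using exists_coloredTellTale C hk hAng
  let f : ∀ n, ColoredTellTale C k n := WellFounded.fix Nat.lt_wfRel.wf G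
  have hf : ∀ n, f n = G n fun m _ => f m := fun n => WellFounded.fix_eq _ _ _
  refine ⟨fun n => (f n).1.1, fun n => (f n).1.2, fun n => (f n).2.1, fun n => (f n).2.2.1, ?_⟩
  intro i j hij hmem
  rcases lt_trichotomy i j with h | rfl | h
  · have := hG₂ j (fun m _ => f m) i h
    rw [← hf] at this
    exact this hmem
  · exact hmem.2.ne rfl
  · have := hG₁ i (fun m _ => f m) j h hmem
    rw [← hf] at this
    exact this.ne hij

/-- A countable language collection is `k`-list identifiable in the limit
if and only if the index set can be covered by `k` sets, each indexing a subcollection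
that is identifiable in the limit with a single guess. -/
theorem list_identifiable_iff_cover {U : Type*} [Countable U]
    (C : ℕ → Set U) (hC : ∀ i, (C i).Nonempty) (k : ℕ) (hk : 1 ≤ k) :
    ListIdentifiable C k ↔
      ∃ J : Fin k → Set ℕ, (⋃ m, J m) = Set.univ ∧
        ∀ m : Fin k, ∃ Am : List U → ℕ, SingleIdentifiesSub C (J m) Am := by
  classical
  constructor
  · rintro ⟨A, hcard, hA⟩
    obtain ⟨T, c, hck, hT, hc⟩ := exists_coloring C hk
      (hasTellTales_of_list_identifier C hC k Set.univ A hcard fun z _ => hA z)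
    -- an unused colour still needs a nonempty class
    refine ⟨fun m => {j | c j = m ∨ (∀ i, c i ≠ m) ∧ j = 0}, ?_, fun m => ?_⟩
    · refine Set.eq_univ_of_forall fun j => Set.mem_iUnion.2 ⟨⟨c j, hck j⟩, Or.inl rfl⟩
    · refine exists_singleIdentifiesSub C _ ?_ T (fun j _ => hT j) fun j hj i hi => hc i j ?_
      · by_cases h : ∃ j, c j = m
        · exact h.imp fun _ => Or.inl
        · exact ⟨0, Or.inr ⟨not_exists.1 h, rfl⟩⟩
      · rcases hi with hi | ⟨hi, hi0⟩ <;> rcases hj with hj | ⟨hj, hj0⟩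
        · rw [hi, hj]
        · exact absurd hi (hj i)
        · exact absurd hj (hi j)
        · rw [hi0, hj0]
  · rintro ⟨J, hJ, hA⟩
    choose Am hAm using hA
    refine ⟨fun s => Finset.univ.image fun m => Am m s, fun s => ?_, fun z x hx => ?_⟩
    · exact Finset.card_image_le.trans (by simp)
    · obtain ⟨m, hm⟩ := Set.mem_iUnion.1 (hJ ▸ Set.mem_univ z)
      obtain ⟨t₀, ht₀⟩ := (hAm m).2 z hm x hx
      exact ⟨t₀, fun t ht => ⟨Am m (prefixList x t), by simp, ht₀ t ht⟩⟩
end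

section
/- Let U be a countable set, let C : ℕ → Set U be a language collection with every C i nonempty, fix an index z, and let x be an enumeration of C z. For t ∈ ℕ let S_t denote the set of distinct elements among x 1, …, x t. Let I ⊆ ℕ be a set of indices with z ∈ I, and for each i ∈ I let T_i be a finite subset of C i. Then there exists t* ∈ ℕ such that for every t ≥ t*, the set {i ∈ I : S_t ⊆ C i and T_i ⊆ S_t} is nonempty and its minimum equals the minimum of the (nonempty, since it contains z) set {i ∈ I : i ≤ z, C z ⊆ C i, and T_i ⊆ C z}. -/
/-- The set of distinct elements among the first `t` values of the input sequence `x`. -/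
def seenSet {U : Type*} (x : ℕ → U) (t : ℕ) : Set U :=
  {u | ∃ j < t, x j = u}

theorem seenSet_subset_of_isEnumeration {U : Type*} {L : Set U} {x : ℕ → U}
    (hx : IsEnumeration L x) (t : ℕ) : seenSet x t ⊆ L := by
  rintro _ ⟨j, -, rfl⟩
  exact hx.1 j

theorem eventually_mem_seenSet {U : Type*} {L : Set U} {x : ℕ → U}
    (hx : IsEnumeration L x) {u : U} (hu : u ∈ L) :
    ∀ᶠ t in Filter.atTop, u ∈ seenSet x t := by
  obtain ⟨n, rfl⟩ := hx.2 u hu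
  filter_upwards [Filter.eventually_gt_atTop n] with t ht
  exact ⟨n, ht, rfl⟩

theorem eventually_finset_subset_seenSet_iff {U : Type*} {L : Set U} {x : ℕ → U}
    (hx : IsEnumeration L x) (F : Finset U) :
    ∀ᶠ t in Filter.atTop, ((F : Set U) ⊆ seenSet x t ↔ (F : Set U) ⊆ L) := by
  by_cases hF : (F : Set U) ⊆ L
  · have hall : ∀ᶠ t in Filter.atTop, ∀ u ∈ F, u ∈ seenSet x t :=
      (Filter.eventually_all_finset F).2 fun u hu => eventually_mem_seenSet hx (hF hu)
    filter_upwards [hall] with t ht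
    exact iff_of_true ht hF
  · exact .of_forall fun t =>
      iff_of_false (fun h => hF (h.trans (seenSet_subset_of_isEnumeration hx t))) hF

theorem eventually_seenSet_subset_iff {U : Type*} {L : Set U} {x : ℕ → U}
    (hx : IsEnumeration L x) (A : Set U) :
    ∀ᶠ t in Filter.atTop, (seenSet x t ⊆ A ↔ L ⊆ A) := by
  by_cases hA : L ⊆ A
  · exact .of_forall fun t =>
      iff_of_true ((seenSet_subset_of_isEnumeration hx t).trans hA) hA
  · obtain ⟨u, huL, huA⟩ := Set.not_subset.1 hA
    filter_upwards [eventually_mem_seenSet hx huL] with t ht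
    exact iff_of_false (fun h => huA (h ht)) hA

theorem Nat.sInf_sep_le {s : Set ℕ} {z : ℕ} (hz : z ∈ s) :
    sInf {i ∈ s | i ≤ z} = sInf s := by
  refine le_antisymm (Nat.sInf_le ⟨Nat.sInf_mem ⟨z, hz⟩, Nat.sInf_le hz⟩) (Nat.sInf_le ?_)
  exact (Nat.sInf_mem (s := {i ∈ s | i ≤ z}) ⟨z, hz, le_rfl⟩).1

/-- The minimal consistent index whose tell-tale has appeared stabilizes. -/
theorem min_consistent_index_stabilizes {U : Type*} [Countable U]
    (C : ℕ → Set U) (hC : ∀ i, (C i).Nonempty)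
    (z : ℕ) (x : ℕ → U) (hx : IsEnumeration (C z) x)
    (I : Set ℕ) (hzI : z ∈ I)
    (T : ℕ → Finset U) (hT : ∀ i ∈ I, (T i : Set U) ⊆ C i) :
    ∃ tStar : ℕ, ∀ t ≥ tStar,
      {i ∈ I | seenSet x t ⊆ C i ∧ (T i : Set U) ⊆ seenSet x t}.Nonempty ∧
      sInf {i ∈ I | seenSet x t ⊆ C i ∧ (T i : Set U) ⊆ seenSet x t} =
        sInf {i ∈ I | i ≤ z ∧ C z ⊆ C i ∧ (T i : Set U) ⊆ C z} := by
  have hstable : ∀ᶠ t in Filter.atTop, ∀ i ∈ Finset.Iic z,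
      (seenSet x t ⊆ C i ∧ (T i : Set U) ⊆ seenSet x t ↔
        C z ⊆ C i ∧ (T i : Set U) ⊆ C z) :=
    (Filter.eventually_all_finset _).2 fun i _ => by
      filter_upwards [eventually_seenSet_subset_iff hx (C i),
        eventually_finset_subset_seenSet_iff hx (T i)] with t h₁ h₂
      exact and_congr h₁ h₂
  obtain ⟨tStar, htStar⟩ := Filter.eventually_atTop.1 hstable
  refine ⟨tStar, fun t ht => ?_⟩
  have hz : z ∈ {i ∈ I | seenSet x t ⊆ C i ∧ (T i : Set U) ⊆ seenSet x t} :=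
    ⟨hzI, (htStar t ht z (Finset.mem_Iic.2 le_rfl)).2 ⟨subset_rfl, hT z hzI⟩⟩
  refine ⟨⟨z, hz⟩, ?_⟩
  rw [← Nat.sInf_sep_le hz]
  congr 1
  ext i
  have hi := fun h : i ≤ z => htStar t ht i (Finset.mem_Iic.2 h)
  simp only [Set.mem_ofPred_eq]
  tauto
end

section
/- Let U be a countable set, let C : ℕ → Set U be a language collection with every C i nonempty, and let k ≥ 1. If C satisfies the k-Angluin condition, then there is a partition of the index set ℕ into disjoint sets J_1, …, J_k such that for every m ∈ {1,…,k} and every i ∈ J_m, there exists a finite set T ⊆ C i with the property that for every j ∈ J_m with C j ⊊ C i, T is not a subset of C j (i.e., each subcollection indexed by J_m satisfies Angluin's tell-tale condition relative to itself). -/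
/-- If `C` satisfies the `k`-Angluin condition, the index set can be
partitioned into `k` pieces, each of whose induced subcollections satisfies Angluin's
tell-tale condition relative to itself. -/
theorem angluin_stratification {U : Type*} [Countable U]
    (C : ℕ → Set U) (hC : ∀ i, (C i).Nonempty) (k : ℕ) (hk : 1 ≤ k)
    (h : AngluinCondition C k) :
    ∃ J : Fin k → Set ℕ,
      (⋃ m, J m) = Set.univ ∧
      (∀ m m' : Fin k, m ≠ m' → Disjoint (J m) (J m')) ∧
      ∀ m : Fin k, ∀ i ∈ J m, ∃ T : Finset U, (T : Set U) ⊆ C i ∧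
        ∀ j ∈ J m, C j ⊂ C i → ¬((T : Set U) ⊆ C j) := by
  classical
  have hex (i : ℕ) : ∃ n, Psi C (n + 1) (C i) := ⟨k - 1, by
    rw [Nat.sub_add_cancel hk]
    exact h i⟩
  have hlt (i : ℕ) : Nat.find (hex i) < k := by
    have hle : Nat.find (hex i) ≤ k - 1 := Nat.find_min' (hex i) (by
      rw [Nat.sub_add_cancel hk]
      exact h i)
    omega
  refine ⟨fun m => {i | Nat.find (hex i) = m}, ?_, ?_, ?_⟩
  · exact Set.eq_univ_of_forall fun i => Set.mem_iUnion.2 ⟨⟨_, hlt i⟩, rfl⟩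
  · intro m m' hne
    exact Set.disjoint_left.2 fun i hi hi' => hne (Fin.ext (hi.symm.trans hi'))
  · rintro ⟨m, hm⟩ i hi
    have hPsi : Psi C (m + 1) (C i) := by
      have hspec := Nat.find_spec (hex i)
      rwa [show Nat.find (hex i) = m from hi] at hspec
    cases m with
    | zero =>
      obtain ⟨T, hT, hTj⟩ := hPsi
      exact ⟨T, hT, fun j _ => hTj j⟩
    | succ n =>
      obtain ⟨T, hT, hTj⟩ := hPsi
      refine ⟨T, hT, fun j hj hji => (hTj j hji).resolve_right fun hP => ?_⟩
      have hle : Nat.find (hex j) ≤ n := Nat.find_min' (hex j) hP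
      have heq : Nat.find (hex j) = n + 1 := hj
      omega
end

section
/- Fix k ≥ 1 and let C : ℕ → Set ℤ be any surjective enumeration of the family of languages {ℤ \ F : F ⊆ ℤ finite with |F| ≤ k} (which includes ℤ itself, for F = ∅). Then C does not satisfy the k-Angluin condition; in fact the predicate Ψ_k(ℤ) fails. -/
/-- Every finite subset of the complement of a finite set `F` is contained in an enumerated
language that omits exactly one further point. -/
theorem exists_index_compl_insert {U : Type*} [Infinite U] [DecidableEq U] {C : ℕ → Set U} {k : ℕ}
    (hsurj : ∀ F : Finset U, F.card ≤ k → ∃ i : ℕ, C i = (↑F : Set U)ᶜ)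
    {F T : Finset U} (hF : F.card + 1 ≤ k) (hT : (T : Set U) ⊆ (↑F : Set U)ᶜ) :
    ∃ (x : U) (j : ℕ), x ∉ F ∧ C j = (↑(insert x F) : Set U)ᶜ ∧
      C j ⊂ (↑F : Set U)ᶜ ∧ (T : Set U) ⊆ C j := by
  obtain ⟨x, hx⟩ := Infinite.exists_notMem_finset (T ∪ F)
  rw [Finset.mem_union, not_or] at hx
  obtain ⟨j, hj⟩ := hsurj (insert x F) (by rwa [Finset.card_insert_of_notMem hx.2])
  refine ⟨x, j, hx.2, hj, ?_, ?_⟩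
  · rw [hj, Set.ssubset_def, Set.compl_subset_compl, Set.compl_subset_compl, ← Set.ssubset_def, Finset.coe_ssubset]
    exact Finset.ssubset_insert hx.2
  · intro y hy
    have hyF : y ∉ F := by simpa using hT hy
    have hyx : y ≠ x := fun h => hx.1 (h ▸ hy)
    simp [hj, hyx, hyF]

/-- If every cofinite set missing at most `k` points is enumerated by `C`, then `Ψ_(m+1)` fails
at the complement of each finite set with at most `k - (m + 1)` points. -/
theorem not_psi_compl_of_card_add_le {U : Type*} [Infinite U] {C : ℕ → Set U} {k : ℕ}
    (hsurj : ∀ F : Finset U, F.card ≤ k → ∃ i : ℕ, C i = (↑F : Set U)ᶜ)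
    (m : ℕ) (F : Finset U) (hF : F.card + (m + 1) ≤ k) :
    ¬ Psi C (m + 1) (↑F : Set U)ᶜ := by
  classical
  induction m generalizing F with
  | zero =>
    rintro ⟨T, hT, h⟩
    obtain ⟨-, j, -, -, hlt, hTj⟩ := exists_index_compl_insert hsurj (by omega) hT
    exact h j hlt hTj
  | succ m ih =>
    rintro ⟨T, hT, h⟩
    obtain ⟨x, j, hx, hj, hlt, hTj⟩ := exists_index_compl_insert hsurj (by omega) hT
    refine (h j hlt).elim (fun hn => hn hTj) ?_
    rw [hj]
    exact ih (insert x F) (by rw [Finset.card_insert_of_notMem hx]; omega)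

/-- Any surjective enumeration `C` of the family
`{ℤ \ F : F ⊆ ℤ finite, |F| ≤ k}` fails the `k`-Angluin condition;
in fact `Ψ_k(ℤ)` fails. -/
theorem canonical_collection_fails_k_angluin (k : ℕ) (hk : 1 ≤ k)
    (C : ℕ → Set ℤ)
    (hrange : ∀ i : ℕ, ∃ F : Finset ℤ, F.card ≤ k ∧ C i = (↑F : Set ℤ)ᶜ)
    (hsurj : ∀ F : Finset ℤ, F.card ≤ k → ∃ i : ℕ, C i = (↑F : Set ℤ)ᶜ) :
    ¬ Psi C k (Set.univ : Set ℤ) ∧ ¬ AngluinCondition C k := by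
  obtain ⟨m, rfl⟩ := Nat.exists_eq_add_of_le' hk
  have huniv : ¬ Psi C (m + 1) (Set.univ : Set ℤ) := by
    simpa using not_psi_compl_of_card_add_le hsurj m ∅ (by simp)
  refine ⟨huniv, fun hC => huniv ?_⟩
  obtain ⟨i, hi⟩ := hsurj ∅ (by simp)
  simpa [hi] using hC i
end

section
/- Fix k ≥ 1 and let C : ℕ → Set ℤ be any surjective enumeration of the family of languages {ℤ \ F : F ⊆ ℤ finite with |F| ≤ k} (which includes ℤ itself, for F = ∅). Then C satisfies the (k+1)-Angluin condition. -/
/-- In a collection of complements of finite sets of size at most `k`, the complement of `F`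
satisfies `Ψ_{n+1}` as soon as at most `n` further elements can be removed from it. -/
theorem Psi.succ_compl_of_le_card_add {U : Type*} {C : ℕ → Set U} {k : ℕ}
    (hrange : ∀ i : ℕ, ∃ F : Finset U, F.card ≤ k ∧ C i = (↑F : Set U)ᶜ)
    (n : ℕ) (F : Finset U) (hF : k ≤ F.card + n) :
    Psi C (n + 1) (↑F : Set U)ᶜ := by
  have card_lt {F G : Finset U} (h : (↑G : Set U)ᶜ ⊂ (↑F : Set U)ᶜ) : F.card < G.card :=
    Finset.card_lt_card (Finset.coe_ssubset.mp (compl_lt_compl_iff_lt.mp h))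
  induction n generalizing F with
  | zero =>
    refine ⟨∅, by simp, fun j hj _ => ?_⟩
    obtain ⟨G, hG, hCj⟩ := hrange j
    have := card_lt (hCj ▸ hj)
    omega
  | succ n ih =>
    refine ⟨∅, by simp, fun j hj => Or.inr ?_⟩
    obtain ⟨G, -, hCj⟩ := hrange j
    rw [hCj] at hj ⊢
    have := card_lt hj
    exact ih G (by omega)

/-- Any surjective enumeration `C` of the family
`{ℤ \ F : F ⊆ ℤ finite, |F| ≤ k}` satisfies the `(k+1)`-Angluin condition. -/
theorem canonical_collection_satisfies_succ_angluin (k : ℕ) (hk : 1 ≤ k)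
    (C : ℕ → Set ℤ)
    (hrange : ∀ i : ℕ, ∃ F : Finset ℤ, F.card ≤ k ∧ C i = (↑F : Set ℤ)ᶜ)
    (hsurj : ∀ F : Finset ℤ, F.card ≤ k → ∃ i : ℕ, C i = (↑F : Set ℤ)ᶜ) :
    AngluinCondition C (k + 1) := by
  intro i
  obtain ⟨F, -, hCi⟩ := hrange i
  rw [hCi]
  exact Psi.succ_compl_of_le_card_add hrange k F (Nat.le_add_left k _)
end

section
/- Let U be a countable set, let C : ℕ → Set U be a language collection with every C i nonempty, let k ≥ 1, and let p > k/(k+1). If there exists a probabilistic k-list identifier that identifies C in the limit with probability p, then C is k-list identifiable in the limit by a deterministic k-list identifier. -/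
open MeasureTheory

/-- `μ` is the infinite product of fair-coin (Bernoulli(1/2)) measures on `{0,1}^ℕ`:
it is a probability measure giving every cylinder of length `t` measure `2⁻ᵗ`. -/
def IsBernoulliProduct (μ : Measure (ℕ → Bool)) : Prop :=
  IsProbabilityMeasure μ ∧
  ∀ (t : ℕ) (b : Fin t → Bool),
    μ {r : ℕ → Bool | ∀ j : Fin t, r (j : ℕ) = b j} = (2 : ENNReal)⁻¹ ^ t

/-- The probabilistic `k`-list identifier `B` identifies `C` in the limit with
probability (at least) `p`. -/
def ProbIdentifiesInLimit {U : Type*} (C : ℕ → Set U) (k : ℕ)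
    (B : List (U × Bool) → Finset ℕ) (p : ENNReal) : Prop :=
  (∀ s, (B s).card ≤ k) ∧
  ∀ z : ℕ, ∀ x : ℕ → U, IsEnumeration (C z) x →
    ∀ μ : Measure (ℕ → Bool), IsBernoulliProduct μ →
      p ≤ μ {r : ℕ → Bool | ∃ tStar : ℕ, ∀ t ≥ tStar,
        ∃ i ∈ B (List.ofFn fun j : Fin t => (x (j : ℕ), r (j : ℕ))), C i = C z}

/-- The least index of the language `C i`. -/
noncomputable def leastIndex {U : Type*} (C : ℕ → Set U) (i : ℕ) : ℕ :=
  sInf {j | C j = C i}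

theorem apply_leastIndex {U : Type*} (C : ℕ → Set U) (i : ℕ) : C (leastIndex C i) = C i :=
  Nat.sInf_mem (s := {j | C j = C i}) ⟨i, rfl⟩

theorem leastIndex_congr {U : Type*} {C : ℕ → Set U} {i j : ℕ} (h : C i = C j) :
    leastIndex C i = leastIndex C j := by
  simp only [leastIndex, h]

open Classical in
/-- The coin sequences on which `B`, reading `y`, lists an index of the language `C i`. -/
noncomputable def goodCoins {U : Type*} (C : ℕ → Set U) (B : List (U × Bool) → Finset ℕ)
    {t : ℕ} (y : Fin t → U) (i : ℕ) : Finset (Fin t → Bool) :=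
  {b | ∃ j ∈ B (List.ofFn fun l => (y l, b l)), C j = C i}

/-- The least indices of the languages listed by `B` on more than a `k / (k + 1)` fraction of
the coin sequences. -/
noncomputable def majorityList {U : Type*} (C : ℕ → Set U) (k : ℕ)
    (B : List (U × Bool) → Finset ℕ) {t : ℕ} (y : Fin t → U) : Finset ℕ :=
  {i ∈ (Finset.univ.biUnion fun b : Fin t → Bool =>
      B (List.ofFn fun l => (y l, b l))).image (leastIndex C) |
    k * 2 ^ t < (k + 1) * (goodCoins C B y i).card}

theorem leastIndex_mem_majorityList {U : Type*} {C : ℕ → Set U} {k : ℕ}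
    {B : List (U × Bool) → Finset ℕ} {t : ℕ} {y : Fin t → U} {z : ℕ}
    (h : k * 2 ^ t < (k + 1) * (goodCoins C B y z).card) :
    leastIndex C z ∈ majorityList C k B y := by
  classical
  have hpos : 0 < (goodCoins C B y z).card := Nat.pos_of_ne_zero fun h0 => by simp [h0] at h
  obtain ⟨b, hb⟩ := Finset.card_pos.1 hpos
  obtain ⟨j, hj, hjz⟩ : ∃ j ∈ B (List.ofFn fun l => (y l, b l)), C j = C z := by
    simpa [goodCoins] using hb
  refine Finset.mem_filter.2 ⟨Finset.mem_image.2 ⟨j, ?_, leastIndex_congr hjz⟩, ?_⟩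
  · exact Finset.mem_biUnion.2 ⟨b, Finset.mem_univ b, hj⟩
  · simpa only [goodCoins, apply_leastIndex] using h

theorem card_majorityList_le {U : Type*} (C : ℕ → Set U) {k : ℕ}
    {B : List (U × Bool) → Finset ℕ} (hB : ∀ s, (B s).card ≤ k) {t : ℕ} (y : Fin t → U) :
    (majorityList C k B y).card ≤ k := by
  classical
  set M := majorityList C k B y with hM
  have hrep : ∀ i ∈ M, leastIndex C i = i := by
    intro i hi
    obtain ⟨j, -, rfl⟩ := Finset.mem_image.1 (Finset.mem_filter.1 hi).1
    exact leastIndex_congr (apply_leastIndex C j)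
  have hsum : ∑ i ∈ M, (goodCoins C B y i).card ≤ k * 2 ^ t := by
    calc ∑ i ∈ M, (goodCoins C B y i).card
        = ∑ b : Fin t → Bool,
            (M.filter fun i => ∃ j ∈ B (List.ofFn fun l => (y l, b l)), C j = C i).card := by
          simp only [goodCoins]
          exact Finset.sum_card_bipartiteAbove_eq_sum_card_bipartiteBelow _
      _ ≤ ∑ _b : Fin t → Bool, k := by
          refine Finset.sum_le_sum fun b _ => le_trans (Finset.card_le_card ?_)
            (Finset.card_image_le.trans (hB (List.ofFn fun l => (y l, b l)))
              : ((B (List.ofFn fun l => (y l, b l))).image (leastIndex C)).card ≤ k)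
          intro i hi
          obtain ⟨hiM, j, hj, hji⟩ := Finset.mem_filter.1 hi
          exact Finset.mem_image.2 ⟨j, hj, (leastIndex_congr hji).trans (hrep i hiM)⟩
      _ = k * 2 ^ t := by simp [mul_comm]
  have hlow : M.card * (k * 2 ^ t + 1) ≤ (k + 1) * ∑ i ∈ M, (goodCoins C B y i).card := by
    rw [Finset.mul_sum, ← smul_eq_mul]
    exact Finset.card_nsmul_le_sum _ _ _ fun i hi => (Finset.mem_filter.1 hi).2
  by_contra! hlt
  nlinarith [Nat.mul_le_mul_right (k * 2 ^ t + 1) hlt, Nat.mul_le_mul_left (k + 1) hsum]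

theorem exists_isBernoulliProduct : ∃ μ : Measure (ℕ → Bool), IsBernoulliProduct μ := by
  classical
  let ν : Measure Bool := (PMF.uniformOfFintype Bool).toMeasure
  have hν : ∀ a, ν {a} = 2⁻¹ := fun a => by
    rw [PMF.toMeasure_apply_singleton _ _ (measurableSet_singleton a)]
    simp
  refine ⟨Measure.infinitePi fun _ : ℕ => ν, inferInstance, fun t b => ?_⟩
  have hset : {r : ℕ → Bool | ∀ j : Fin t, r (j : ℕ) = b j} =
      Set.pi (Finset.range t : Set ℕ) fun n => if h : n < t then {b ⟨n, h⟩} else Set.univ := by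
    ext r
    simp only [Set.mem_ofPred_eq, Set.mem_pi, Finset.coe_range, Set.mem_Iio]
    constructor
    · intro h n hn
      simpa [hn] using h ⟨n, hn⟩
    · intro h j
      simpa using h j j.2
  rw [hset, Measure.infinitePi_pi _ fun _ _ => MeasurableSet.of_discrete,
    Finset.prod_congr rfl (g := fun _ => 2⁻¹)]
  · simp
  · intro n hn
    simp [Finset.mem_range.1 hn, hν]

theorem IsBernoulliProduct.measure_setOf_restrict_mem_le {μ : Measure (ℕ → Bool)}
    (hμ : IsBernoulliProduct μ) {t : ℕ} (S : Finset (Fin t → Bool)) :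
    μ {r | (fun j : Fin t => r j) ∈ S} ≤ S.card * (2 : ENNReal)⁻¹ ^ t := by
  calc μ {r | (fun j : Fin t => r j) ∈ S}
      ≤ μ (⋃ b ∈ S, {r : ℕ → Bool | ∀ j : Fin t, r (j : ℕ) = b j}) :=
        measure_mono fun r hr => Set.mem_biUnion (x := fun j : Fin t => r j) hr fun _ => rfl
    _ ≤ ∑ b ∈ S, μ {r : ℕ → Bool | ∀ j : Fin t, r (j : ℕ) = b j} :=
        measure_biUnion_finset_le _ _
    _ = S.card * (2 : ENNReal)⁻¹ ^ t := by simp [hμ.2]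

theorem mul_two_pow_lt_of_div_lt {k t n : ℕ}
    (h : (k : ENNReal) / ((k : ENNReal) + 1) < n * (2 : ENNReal)⁻¹ ^ t) :
    k * 2 ^ t < (k + 1) * n := by
  rw [← ENNReal.inv_pow, ← div_eq_mul_inv,
    ENNReal.lt_div_iff_mul_lt (Or.inl (by simp)) (Or.inl (by finiteness)), mul_comm,
    ← mul_div_assoc, ENNReal.div_lt_iff (Or.inl (by simp)) (Or.inl (by finiteness))] at h
  have h' : 2 ^ t * k < n * (k + 1) := by exact_mod_cast h
  linarith

/-- If some probabilistic `k`-list identifier identifies `C` in the limit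
with probability `p > k/(k+1)`, then `C` is deterministically `k`-list identifiable in the
limit. -/
theorem probabilistic_to_deterministic {U : Type*} [Countable U]
    (C : ℕ → Set U) (hC : ∀ i, (C i).Nonempty) (k : ℕ) (hk : 1 ≤ k)
    (p : ENNReal) (hp : (k : ENNReal) / ((k : ENNReal) + 1) < p)
    (h : ∃ B : List (U × Bool) → Finset ℕ, ProbIdentifiesInLimit C k B p) :
    ListIdentifiable C k := by
  obtain ⟨B, hB, hprob⟩ := h
  obtain ⟨μ, hμ⟩ := exists_isBernoulliProduct
  refine ⟨fun s => majorityList C k B (List.equivSigmaTuple s).2,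
    fun s => card_majorityList_le C hB _, fun z x hx => ?_⟩
  have hlt := hp.trans_le (hprob z x hx μ hμ)
  have hmono : Monotone fun T => {r : ℕ → Bool | ∀ t ≥ T,
      ∃ i ∈ B (List.ofFn fun j : Fin t => (x (j : ℕ), r (j : ℕ))), C i = C z} :=
    fun a b hab r hr t ht => hr t (hab.trans ht)
  rw [Set.ofPred_exists, hmono.measure_iUnion] at hlt
  obtain ⟨T, hT⟩ := lt_iSup_iff.1 hlt
  refine ⟨T, fun t ht => ⟨leastIndex C z, ?_, apply_leastIndex C z⟩⟩
  have heq : List.equivSigmaTuple (prefixList x t) = ⟨t, fun j : Fin t => x j⟩ :=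
    List.equivSigmaTuple.apply_symm_apply ⟨t, fun j : Fin t => x j⟩
  beta_reduce
  rw [heq]
  refine leastIndex_mem_majorityList (mul_two_pow_lt_of_div_lt (hT.trans_le ?_))
  refine (measure_mono fun r hr => ?_).trans (hμ.measure_setOf_restrict_mem_le _)
  simpa [goodCoins] using hr t ht
end

section
/- Let U be a countable set, let C : ℕ → Set U be a language collection with every C i nonempty, let k ≥ 1, and let p ∈ [0,1]. If there exists a deterministic k-list identifier that identifies C in the limit with probability p on infinite draws, then there exists a probabilistic k-list identifier that identifies C in the limit with probability p. -/
open MeasureTheory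

/-- The probability distribution `D` on `U` is valid for the language `L`:
`D({u}) > 0` if and only if `u ∈ L`. -/
def IsValidFor {U : Type*} [MeasurableSpace U] (D : Measure U) (L : Set U) : Prop :=
  IsProbabilityMeasure D ∧ ∀ u : U, 0 < D {u} ↔ u ∈ L

/-- `μ` is the infinite i.i.d. product `D^∞` on `U^ℕ` of the distribution `D`:
it is a probability measure whose finite-dimensional cylinder marginals are products of
`D`. -/
def IsIIDProduct {U : Type*} [MeasurableSpace U] (D : Measure U)
    (μ : Measure (ℕ → U)) : Prop :=
  IsProbabilityMeasure μ ∧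
  ∀ (t : ℕ) (S : Fin t → Set U),
    μ {f : ℕ → U | ∀ j : Fin t, f (j : ℕ) ∈ S j} = ∏ j : Fin t, D (S j)

/-- The deterministic `k`-list identifier `A` identifies `C` in the limit with probability
(at least) `p` on infinite draws. -/
def IdentifiesOnDraws {U : Type*} [MeasurableSpace U] (C : ℕ → Set U) (k : ℕ)
    (A : List U → Finset ℕ) (p : ENNReal) : Prop :=
  (∀ s, (A s).card ≤ k) ∧
  ∀ z : ℕ, ∀ D : Measure U, IsValidFor D (C z) →
    ∀ μ : Measure (ℕ → U), IsIIDProduct D μ →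
      p ≤ μ {x : ℕ → U | ∃ tStar : ℕ, ∀ t ≥ tStar,
        ∃ i ∈ A (prefixList x t), C i = C z}

/-- The lengths of the maximal blocks of `false` that are closed by a `true` in a bit list, where
`c` further copies of `false` are assumed to precede the list. -/
def completedGaps : ℕ → List Bool → List ℕ
  | _, [] => []
  | c, false :: l => completedGaps (c + 1) l
  | c, true :: l => c :: completedGaps 0 l

/-- The position of the first `true` (`0` if there is none). -/
noncomputable def firstTrue (r : ℕ → Bool) : ℕ := sInf {n | r n = true}

/-- The bit sequence that follows the first `true`. -/
noncomputable def afterFirstTrue (r : ℕ → Bool) : ℕ → Bool := fun i => r (firstTrue r + 1 + i)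

/-- The sequence of lengths of the blocks of `false` that precede successive `true`s. -/
noncomputable def gaps (r : ℕ → Bool) (j : ℕ) : ℕ := firstTrue (afterFirstTrue^[j] r)

/-- The event that the first `true` is at position `n`. -/
def firstTrueAt (n : ℕ) : Set (ℕ → Bool) := {r | (∀ i < n, r i = false) ∧ r n = true}

/-- The indices `completedGaps` reads off the bits of `s`, looked up in `s` itself. -/
def simulatedDraws {U : Type*} (s : List (U × Bool)) : List U :=
  (completedGaps 0 (s.map Prod.snd)).filterMap fun g => s[g]?.map Prod.fst

theorem prefixList_succ {U : Type*} (x : ℕ → U) (t : ℕ) :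
    prefixList x (t + 1) = x 0 :: prefixList (fun i => x (i + 1)) t := by
  simp [prefixList, List.ofFn_succ]

theorem map_prefixList {U V : Type*} (f : U → V) (x : ℕ → U) (t : ℕ) :
    (prefixList x t).map f = prefixList (fun i => f (x i)) t := by
  simp [prefixList, List.map_ofFn, Function.comp_def]

theorem lt_of_mem_completedGaps {c g : ℕ} {l : List Bool} (h : g ∈ completedGaps c l) :
    g < c + l.length := by
  induction l generalizing c with
  | nil => simp [completedGaps] at h
  | cons b l ih =>
    cases b with
    | false =>
      have := ih h
      simp only [List.length_cons]
      omega
    | true =>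
      rcases List.mem_cons.1 h with rfl | h
      · simp
      · have := ih h
        simp only [List.length_cons]
        omega

theorem completedGaps_eq_nil {r : ℕ → Bool} {t : ℕ} (h : ∀ i < t, r i = false) (c : ℕ) :
    completedGaps c (prefixList r t) = [] := by
  induction t generalizing r c with
  | zero => simp [prefixList, completedGaps]
  | succ t ih =>
    rw [prefixList_succ, h 0 (by omega)]
    exact ih (fun i hi => h (i + 1) (by omega)) _

theorem completedGaps_of_mem_firstTrueAt {r : ℕ → Bool} {g : ℕ} (h : r ∈ firstTrueAt g)
    (c t : ℕ) :
    completedGaps c (prefixList r (g + 1 + t)) =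
      (c + g) :: completedGaps 0 (prefixList (fun i => r (g + 1 + i)) t) := by
  induction g generalizing r c with
  | zero =>
    rw [show 0 + 1 + t = t + 1 by omega, prefixList_succ, h.2]
    simp [completedGaps, add_comm]
  | succ g ih =>
    rw [show g + 1 + 1 + t = g + 1 + t + 1 by omega, prefixList_succ, h.1 0 (by omega)]
    have h' : (fun i => r (i + 1)) ∈ firstTrueAt g :=
      ⟨fun i hi => h.1 (i + 1) (by omega), h.2⟩
    refine (ih h' (c + 1)).trans ?_
    congr 1
    · omega
    · congr 2
      funext i
      congr 1
      omega

theorem mem_firstTrueAt_firstTrue {r : ℕ → Bool} (h : ∃ n, r n = true) :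
    r ∈ firstTrueAt (firstTrue r) :=
  ⟨fun _ hi => by simpa using Nat.notMem_of_lt_sInf hi, Nat.sInf_mem (s := {n | r n = true}) h⟩

theorem firstTrue_eq {r : ℕ → Bool} {n : ℕ} (h : r ∈ firstTrueAt n) : firstTrue r = n := by
  have h' := mem_firstTrueAt_firstTrue ⟨n, h.2⟩
  rcases lt_trichotomy (firstTrue r) n with hlt | heq | hlt
  · exact absurd h'.2 (by simp [h.1 _ hlt])
  · exact heq
  · exact absurd h.2 (by simp [h'.1 _ hlt])

theorem gaps_zero (r : ℕ → Bool) : gaps r 0 = firstTrue r := rfl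

theorem gaps_succ (r : ℕ → Bool) (j : ℕ) : gaps r (j + 1) = gaps (afterFirstTrue r) j := by
  simp [gaps]

theorem completedGaps_eq_cons {r : ℕ → Bool} (h : ∃ n, r n = true) (t : ℕ) :
    completedGaps 0 (prefixList r (firstTrue r + 1 + t)) =
      firstTrue r :: completedGaps 0 (prefixList (afterFirstTrue r) t) := by
  have h' := completedGaps_of_mem_firstTrueAt (mem_firstTrueAt_firstTrue h) 0 t
  rwa [Nat.zero_add] at h'

theorem prefixList_gaps_succ (r : ℕ → Bool) (N : ℕ) :
    prefixList (gaps r) (N + 1) = firstTrue r :: prefixList (gaps (afterFirstTrue r)) N := by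
  rw [prefixList_succ, gaps_zero]
  simp only [gaps_succ]

theorem exists_completedGaps_eq_prefixList (r : ℕ → Bool) (t : ℕ) :
    ∃ N, completedGaps 0 (prefixList r t) = prefixList (gaps r) N := by
  induction t using Nat.strong_induction_on generalizing r with
  | _ t ih =>
    by_cases h : ∃ n < t, r n = true
    · obtain ⟨n, hn, hr⟩ := h
      have hle : firstTrue r ≤ n := Nat.sInf_le hr
      obtain ⟨s, rfl⟩ := Nat.exists_eq_add_of_le (show firstTrue r + 1 ≤ t by omega)
      obtain ⟨N, hN⟩ := ih s (by omega) (afterFirstTrue r)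
      exact ⟨N + 1, by rw [completedGaps_eq_cons ⟨n, hr⟩, prefixList_gaps_succ, hN]⟩
    · push Not at h
      exact ⟨0, by rw [completedGaps_eq_nil (fun i hi => by simpa using h i hi)]; simp [prefixList]⟩

theorem eventually_completedGaps_eq_prefixList {r : ℕ → Bool} (h : ∀ m, ∃ n, r (m + n) = true)
    (N : ℕ) :
    ∃ T, ∀ t ≥ T, ∃ M ≥ N, completedGaps 0 (prefixList r t) = prefixList (gaps r) M := by
  induction N generalizing r with
  | zero =>
    refine ⟨0, fun t _ => ?_⟩
    obtain ⟨M, hM⟩ := exists_completedGaps_eq_prefixList r t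
    exact ⟨M, M.zero_le, hM⟩
  | succ N ih =>
    have h' : ∀ m, ∃ n, afterFirstTrue r (m + n) = true := fun m => by
      obtain ⟨n, hn⟩ := h (firstTrue r + 1 + m)
      exact ⟨n, by rwa [afterFirstTrue, ← add_assoc]⟩
    obtain ⟨T, hT⟩ := ih h'
    refine ⟨firstTrue r + 1 + T, fun t ht => ?_⟩
    obtain ⟨s, rfl⟩ := Nat.exists_eq_add_of_le (show firstTrue r + 1 ≤ t by omega)
    obtain ⟨M, hM, hs⟩ := hT s (by omega)
    have h0 : ∃ n, r n = true := by simpa using h 0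
    exact ⟨M + 1, by omega, by rw [completedGaps_eq_cons h0, prefixList_gaps_succ, hs]⟩

theorem simulatedDraws_ofFn {U : Type*} (x : ℕ → U) (r : ℕ → Bool) (t : ℕ) :
    simulatedDraws (List.ofFn fun j : Fin t => (x (j : ℕ), r (j : ℕ))) =
      (completedGaps 0 (prefixList r t)).map x := by
  have hbits : (List.ofFn fun j : Fin t => (x (j : ℕ), r (j : ℕ))).map Prod.snd =
      prefixList r t := by
    simp [prefixList, List.map_ofFn, Function.comp_def]
  rw [simulatedDraws, hbits, ← List.filterMap_eq_map]
  refine List.filterMap_congr fun g hg => ?_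
  have hlt : g < t := by simpa [prefixList] using lt_of_mem_completedGaps hg
  simp [hlt]

theorem measurableSet_bit_eq (n : ℕ) (b : Bool) : MeasurableSet {r : ℕ → Bool | r n = b} :=
  measurableSet_eq_fun (measurable_pi_apply n) measurable_const

theorem measurableSet_cylinder (m : ℕ) (b : ℕ → Bool) :
    MeasurableSet {r : ℕ → Bool | ∀ i < m, r i = b i} := by
  measurability

theorem measurableSet_firstTrueAt (n : ℕ) : MeasurableSet (firstTrueAt n) := by
  have : firstTrueAt n = {r | ∀ i < n, r i = false} ∩ {r | r n = true} := rfl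
  rw [this]
  exact (measurableSet_cylinder n fun _ => false).inter (measurableSet_bit_eq n true)

theorem measurable_firstTrue : Measurable firstTrue := by
  have hset : MeasurableSet {r : ℕ → Bool | ∃ n, r n = true} := by
    simp only [Set.ofPred_exists]
    exact MeasurableSet.iUnion fun n => measurableSet_bit_eq n true
  refine measurable_to_countable' fun n => ?_
  have : firstTrue ⁻¹' {n} =
      firstTrueAt n ∪ ({r : ℕ → Bool | ∃ n, r n = true}ᶜ ∩ {_r | n = 0}) := by
    ext r
    by_cases h : ∃ n, r n = true
    · have : firstTrue r = n ↔ r ∈ firstTrueAt n :=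
        ⟨fun e => e ▸ mem_firstTrueAt_firstTrue h, firstTrue_eq⟩
      simpa [h] using this
    · have hn : r ∉ firstTrueAt n := fun hr => h ⟨n, hr.2⟩
      have : firstTrue r = 0 := by
        push Not at h
        simp [firstTrue, h]
      simp only [Set.mem_preimage, Set.mem_singleton_iff, this, Set.mem_union, hn, false_or,
        Set.mem_inter_iff, Set.mem_compl_iff, Set.mem_ofPred_eq, h, not_false_eq_true, true_and]
      exact eq_comm
  rw [this]
  exact (measurableSet_firstTrueAt n).union (hset.compl.inter (MeasurableSet.const _))

theorem measurable_afterFirstTrue : Measurable afterFirstTrue := by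
  refine measurable_pi_lambda _ fun i => ?_
  have : Measurable fun q : ℕ × (ℕ → Bool) => q.2 (q.1 + 1 + i) :=
    measurable_from_prod_countable_right fun n => measurable_pi_apply (n + 1 + i)
  exact this.comp (measurable_firstTrue.prodMk measurable_id)

theorem measurable_gaps : Measurable gaps :=
  measurable_pi_lambda _ fun j => measurable_firstTrue.comp (measurable_afterFirstTrue.iterate j)

/-- Two finite measures on bit sequences that agree on all cylinders are equal. -/
theorem measure_ext_of_cylinder {μ ν : Measure (ℕ → Bool)} [IsFiniteMeasure μ]
    (h : ∀ (t : ℕ) (b : ℕ → Bool),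
      μ {r | ∀ i < t, r i = b i} = ν {r | ∀ i < t, r i = b i}) : μ = ν := by
  let S : Set (Set (ℕ → Bool)) := {s | ∃ (b : ℕ → Bool) (t : ℕ), s = PiNat.cylinder b t}
  have hgen : (inferInstance : MeasurableSpace (ℕ → Bool)) = MeasurableSpace.generateFrom S := by
    rw [BorelSpace.measurable_eq (α := ℕ → Bool)]
    exact (PiNat.isTopologicalBasis_cylinders (fun _ => Bool)).borel_eq_generateFrom
  refine ext_of_generate_finite S hgen ?_ ?_ (by simpa using h 0 fun _ => false)
  · rintro _ ⟨b, t, rfl⟩ _ ⟨b', t', rfl⟩ ⟨r, hr, hr'⟩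
    rw [PiNat.mem_cylinder_iff_eq] at hr hr'
    refine ⟨r, max t t', ?_⟩
    rw [← hr, ← hr']
    ext q
    simp only [Set.mem_inter_iff, PiNat.mem_cylinder_iff, lt_max_iff]
    exact ⟨fun hq i hi => hi.elim (hq.1 i) (hq.2 i),
      fun hq => ⟨fun i hi => hq i (.inl hi), fun i hi => hq i (.inr hi)⟩⟩
  · rintro _ ⟨b, t, rfl⟩
    exact h t b

namespace IsBernoulliProduct

variable {μ : Measure (ℕ → Bool)}

theorem measure_cylinder (hμ : IsBernoulliProduct μ) (m : ℕ) (b : ℕ → Bool) :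
    μ {r | ∀ i < m, r i = b i} = (2 : ENNReal)⁻¹ ^ m := by
  rw [← hμ.2 m fun j => b j]
  congr 1
  ext r
  exact ⟨fun h j => h j j.2, fun h i hi => h ⟨i, hi⟩⟩

/-- After conditioning on the first `m` bits, the remaining bits are again fair and independent. -/
theorem measure_cylinder_inter_shift (hμ : IsBernoulliProduct μ) (m : ℕ) (b : ℕ → Bool)
    {E : Set (ℕ → Bool)} (hE : MeasurableSet E) :
    μ ({r | ∀ i < m, r i = b i} ∩ {r | (fun i => r (m + i)) ∈ E}) =
      (2 : ENNReal)⁻¹ ^ m * μ E := by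
  have := hμ.1
  have hshift : Measurable fun (r : ℕ → Bool) i => r (m + i) :=
    measurable_pi_lambda _ fun i => measurable_pi_apply (m + i)
  have hmap : ∀ {F : Set (ℕ → Bool)}, MeasurableSet F →
      (μ.restrict {r | ∀ i < m, r i = b i}).map (fun r i => r (m + i)) F =
        μ ({r | ∀ i < m, r i = b i} ∩ {r | (fun i => r (m + i)) ∈ F}) := fun hF => by
    rw [Measure.map_apply hshift hF, Measure.restrict_apply (hshift hF), Set.inter_comm]
    rfl
  have key : (μ.restrict {r | ∀ i < m, r i = b i}).map (fun r i => r (m + i)) =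
      (2 : ENNReal)⁻¹ ^ m • μ := by
    refine measure_ext_of_cylinder fun t c => ?_
    rw [hmap (measurableSet_cylinder t c), Measure.smul_apply, hμ.measure_cylinder, smul_eq_mul,
      ← pow_add, ← hμ.measure_cylinder (m + t) fun i => if i < m then b i else c (i - m)]
    congr 1
    ext r
    constructor
    · rintro ⟨h₁, h₂⟩ i hi
      by_cases him : i < m
      · simp [him, h₁ i him]
      · have := h₂ (i - m) (by omega)
        simp only [him, if_false, ← this]
        congr 1
        omega
    · intro h
      refine ⟨fun i hi => by simpa [hi] using h i (by omega), fun i hi => ?_⟩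
      simpa using h (m + i) (by omega)
  rw [← hmap hE, key, Measure.smul_apply, smul_eq_mul]

theorem measure_all_false (hμ : IsBernoulliProduct μ) : μ {r | ∀ n, r n = false} = 0 := by
  have hle : ∀ m : ℕ, μ {r | ∀ n, r n = false} ≤ (2 : ENNReal)⁻¹ ^ m := fun m => by
    rw [← hμ.measure_cylinder m fun _ => false]
    exact measure_mono fun r hr i _ => hr i
  refine le_antisymm (ge_of_tendsto' (ENNReal.tendsto_pow_atTop_nhds_zero_of_lt_one ?_) hle)
    zero_le
  exact ENNReal.inv_lt_one.2 ENNReal.one_lt_two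

theorem ae_exists_true (hμ : IsBernoulliProduct μ) : ∀ᵐ r ∂μ, ∀ m, ∃ n, r (m + n) = true := by
  refine ae_all_iff.2 fun m => ?_
  have hmeas : MeasurableSet {r : ℕ → Bool | ∀ n, r n = false} := by
    simp only [Set.ofPred_forall]
    exact MeasurableSet.iInter fun n => measurableSet_bit_eq n false
  refine measure_mono_null (t := ⋃ b : Fin m → Bool,
    {r | ∀ i < m, r i = if hi : i < m then b ⟨i, hi⟩ else false} ∩
      {r | (fun i => r (m + i)) ∈ {r : ℕ → Bool | ∀ n, r n = false}}) ?_ ?_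
  · intro r hr
    refine Set.mem_iUnion.2 ⟨fun j => r j, fun i hi => by simp [hi], ?_⟩
    simpa using hr
  · refine measure_iUnion_null fun b => ?_
    rw [hμ.measure_cylinder_inter_shift m _ hmeas, hμ.measure_all_false, mul_zero]

theorem measure_firstTrueAt_inter (hμ : IsBernoulliProduct μ) (n : ℕ) {E : Set (ℕ → Bool)}
    (hE : MeasurableSet E) :
    μ (firstTrueAt n ∩ {r | afterFirstTrue r ∈ E}) = (2 : ENNReal)⁻¹ ^ (n + 1) * μ E := by
  rw [← hμ.measure_cylinder_inter_shift (n + 1) (fun i => decide (i = n)) hE]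
  congr 1
  have hcyl : firstTrueAt n = {r | ∀ i < n + 1, r i = decide (i = n)} := by
    ext r
    constructor
    · rintro ⟨h₁, h₂⟩ i hi
      rcases Nat.lt_succ_iff_lt_or_eq.1 hi with h | rfl
      · simp [h₁ i h, h.ne]
      · simp [h₂]
    · intro h
      exact ⟨fun i hi => by simpa [hi.ne] using h i (by omega), by simpa using h n (by omega)⟩
  rw [← hcyl]
  ext r
  refine and_congr_right fun hr => ?_
  have hshift : afterFirstTrue r = fun i => r (n + 1 + i) := by
    funext i
    rw [afterFirstTrue, firstTrue_eq hr]
  rw [Set.mem_ofPred_eq, Set.mem_ofPred_eq, hshift]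

theorem measure_firstTrue_mem_and (hμ : IsBernoulliProduct μ) (S : Set ℕ) {E : Set (ℕ → Bool)}
    (hE : MeasurableSet E) :
    μ {r | firstTrue r ∈ S ∧ afterFirstTrue r ∈ E} =
      (∑' n, S.indicator (fun n => (2 : ENNReal)⁻¹ ^ (n + 1)) n) * μ E := by
  have hmeas : MeasurableSet {r | firstTrue r ∈ S ∧ afterFirstTrue r ∈ E} :=
    (measurable_firstTrue (MeasurableSet.of_discrete (s := S))).inter
      (measurable_afterFirstTrue hE)
  have hae : {r | firstTrue r ∈ S ∧ afterFirstTrue r ∈ E} =ᵐ[μ]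
      ⋃ n, {r | firstTrue r ∈ S ∧ afterFirstTrue r ∈ E} ∩ firstTrueAt n := by
    filter_upwards [hμ.ae_exists_true] with r hr
    have h0 : ∃ n, r n = true := by simpa using hr 0
    refine propext ⟨fun h => ?_, fun h => ?_⟩
    · exact Set.mem_iUnion.2 ⟨firstTrue r, h, mem_firstTrueAt_firstTrue h0⟩
    · obtain ⟨n, hn⟩ := Set.mem_iUnion.1 h
      exact hn.1
  have hdisj : Pairwise (Function.onFun Disjoint fun n =>
      {r | firstTrue r ∈ S ∧ afterFirstTrue r ∈ E} ∩ firstTrueAt n) := by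
    intro m n hmn
    refine Set.disjoint_left.2 fun r hm hn => hmn ?_
    rw [← firstTrue_eq hm.2, firstTrue_eq hn.2]
  rw [measure_congr hae, measure_iUnion hdisj fun n => hmeas.inter (measurableSet_firstTrueAt n),
    ← ENNReal.tsum_mul_right]
  refine tsum_congr fun n => ?_
  by_cases hn : n ∈ S
  · rw [Set.indicator_of_mem hn, ← hμ.measure_firstTrueAt_inter n hE]
    congr 1
    ext r
    constructor
    · exact fun h => ⟨h.2, h.1.2⟩
    · exact fun h => ⟨⟨by rwa [firstTrue_eq h.1], h.2⟩, h.1⟩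
  · rw [Set.indicator_of_notMem hn, zero_mul]
    refine (congrArg μ ?_).trans measure_empty
    refine Set.eq_empty_of_forall_notMem fun r h => hn ?_
    rw [← firstTrue_eq h.2]
    exact h.1.1

/-- The gaps between successive `true`s are independent and identically distributed. -/
theorem measure_gaps_mem (hμ : IsBernoulliProduct μ) (t : ℕ) (S : Fin t → Set ℕ) :
    μ {r | ∀ j : Fin t, gaps r j ∈ S j} = ∏ j : Fin t, μ {r | firstTrue r ∈ S j} := by
  have := hμ.1
  induction t with
  | zero => simp
  | succ t ih =>
    have hE : MeasurableSet {r | ∀ j : Fin t, gaps r j ∈ S j.succ} := by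
      simp only [Set.ofPred_forall]
      exact MeasurableSet.iInter fun j =>
        ((measurable_pi_apply (j : ℕ)).comp measurable_gaps) (MeasurableSet.of_discrete)
    have hsplit : {r | ∀ j : Fin (t + 1), gaps r j ∈ S j} =
        {r | firstTrue r ∈ S 0 ∧ afterFirstTrue r ∈ {r | ∀ j : Fin t, gaps r j ∈ S j.succ}} := by
      ext r
      simp [Fin.forall_fin_succ, gaps_succ, gaps_zero]
    have h0 := hμ.measure_firstTrue_mem_and (S 0) MeasurableSet.univ
    simp only [Set.mem_univ, and_true, measure_univ, mul_one] at h0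
    rw [hsplit, hμ.measure_firstTrue_mem_and (S 0) hE, Fin.prod_univ_succ, ← h0,
      ih fun j => S j.succ]

end IsBernoulliProduct

theorem measurableSet_identifies_on {U : Type*} [Countable U] [MeasurableSpace U]
    [MeasurableSingletonClass U] (P : List U → Prop) :
    MeasurableSet {x : ℕ → U | ∃ tStar : ℕ, ∀ t ≥ tStar, P (prefixList x t)} := by
  have h : ∀ t, MeasurableSet {x : ℕ → U | P (prefixList x t)} := fun t => by
    have hres : Measurable fun (x : ℕ → U) (j : Fin t) => x j :=
      measurable_pi_lambda _ fun j => measurable_pi_apply (j : ℕ)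
    exact hres (MeasurableSet.of_discrete (s := {y : Fin t → U | P (List.ofFn y)}))
  simp only [Set.ofPred_exists, Set.ofPred_forall]
  exact MeasurableSet.iUnion fun _ => MeasurableSet.iInter fun t => MeasurableSet.iInter fun _ => h t

/-- If some deterministic `k`-list identifier identifies `C` in the limit
with probability `p` on infinite draws, then some probabilistic `k`-list identifier
identifies `C` in the limit with probability `p`. -/
theorem draws_to_probabilistic {U : Type*} [Countable U] [MeasurableSpace U]
    [MeasurableSingletonClass U]
    (C : ℕ → Set U) (hC : ∀ i, (C i).Nonempty) (k : ℕ) (hk : 1 ≤ k)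
    (p : ENNReal) (hp : p ≤ 1)
    (h : ∃ A : List U → Finset ℕ, IdentifiesOnDraws C k A p) :
    ∃ B : List (U × Bool) → Finset ℕ, ProbIdentifiesInLimit C k B p := by
  obtain ⟨A, hcard, hA⟩ := h
  refine ⟨fun s => A (simulatedDraws s), fun s => hcard _, fun z x hx μ hμ => ?_⟩
  have := hμ.1
  have hxm : Measurable x := measurable_from_top
  have hfirst : Measurable fun r => x (firstTrue r) := hxm.comp measurable_firstTrue
  have hdraw : Measurable fun r j => x (gaps r j) :=
    measurable_pi_lambda _ fun j => hxm.comp ((measurable_pi_apply j).comp measurable_gaps)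
  have hvalid : IsValidFor (μ.map fun r => x (firstTrue r)) (C z) := by
    refine ⟨Measure.isProbabilityMeasure_map hfirst.aemeasurable, fun u => ?_⟩
    rw [Measure.map_apply hfirst (measurableSet_singleton u)]
    constructor
    · intro hpos
      obtain ⟨r, hr⟩ := nonempty_of_measure_ne_zero hpos.ne'
      exact hr ▸ hx.1 _
    · intro hu
      obtain ⟨n, rfl⟩ := hx.2 u hu
      have hn := hμ.measure_firstTrueAt_inter n MeasurableSet.univ
      simp only [Set.mem_univ, Set.ofPred_true, Set.inter_univ, measure_univ, mul_one] at hn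
      refine lt_of_lt_of_le ?_ (measure_mono (s := firstTrueAt n) fun r hr => ?_)
      · rw [hn]
        exact ENNReal.pow_pos (by simp) _
      · simp [firstTrue_eq hr]
  have hiid : IsIIDProduct (μ.map fun r => x (firstTrue r)) (μ.map fun r j => x (gaps r j)) := by
    refine ⟨Measure.isProbabilityMeasure_map hdraw.aemeasurable, fun t S => ?_⟩
    have hS : MeasurableSet {f : ℕ → U | ∀ j : Fin t, f (j : ℕ) ∈ S j} := by
      simp only [Set.ofPred_forall]
      exact MeasurableSet.iInter fun j =>
        measurable_pi_apply (j : ℕ) (MeasurableSet.of_discrete (s := S j))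
    rw [Measure.map_apply hdraw hS]
    simp only [Measure.map_apply hfirst MeasurableSet.of_discrete]
    exact hμ.measure_gaps_mem t fun j => x ⁻¹' S j
  refine (hA z _ hvalid _ hiid).trans ?_
  rw [Measure.map_apply hdraw
    (measurableSet_identifies_on fun s => ∃ i ∈ A s, C i = C z)]
  refine measure_mono_ae ?_
  filter_upwards [hμ.ae_exists_true] with r hr
  rintro ⟨N, hN⟩
  obtain ⟨T, hT⟩ := eventually_completedGaps_eq_prefixList hr N
  refine ⟨T, fun t ht => ?_⟩
  obtain ⟨M, hM, hMt⟩ := hT t ht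
  rw [simulatedDraws_ofFn, hMt, map_prefixList]
  exact hN M hM
end

section
/- Let U be a countable set, let C : ℕ → Set U be a language collection with every C i nonempty, and let k ≥ 1. Suppose C does not satisfy the k-Angluin condition. Then for every deterministic k-list identifier A there exist an index z and a probability distribution D valid for C z such that, with probability at least 1/(k+1) under (x_n)_{n∈ℕ} ~ D^∞, there exist infinitely many t ∈ ℕ such that no i ∈ A(x_1, …, x_t) satisfies C i = C z. -/
open MeasureTheory

open Set Filter Topology
open scoped ENNReal NNReal

/-- The Baire category theorem relative to a `Gδ` subset of a Polish space. -/
theorem IsGδ.subset_closure_inter_iInter {X : Type*} [TopologicalSpace X] [PolishSpace X]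
    {s : Set X} (hs : IsGδ s) {V : ℕ → Set X} (hV : ∀ n, IsOpen (V n))
    (hd : ∀ n, s ⊆ closure (s ∩ V n)) : s ⊆ closure (s ∩ ⋂ n, V n) := by
  have hP : PolishSpace (closure s) := isClosed_closure.polishSpace
  have hdense : Dense (⋂ n, ((↑) ⁻¹' (s ∩ V n) : Set (closure s))) := by
    refine dense_iInter_of_Gδ
      (fun n => (hs.inter (hV n).isGδ).preimage continuous_subtype_val) fun n => ?_
    rw [Subtype.dense_iff, Subtype.image_preimage_coe]
    intro x hx
    have hx' := closure_minimal (hd n) isClosed_closure hx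
    rwa [inter_eq_right.mpr (inter_subset_left.trans subset_closure)]
  rw [Subtype.dense_iff] at hdense
  refine fun x hx => closure_mono ?_ (hdense (subset_closure hx))
  rintro _ ⟨y, hy, rfl⟩
  simp only [mem_iInter, mem_preimage, mem_inter_iff] at hy
  exact ⟨(hy 0).1, mem_iInter.2 fun n => (hy n).2⟩

section Weights

variable {U : Type*}

/-- The probability mass functions with support exactly `L`. -/
def validWeights (L : Set U) : Set (U → ℝ≥0) :=
  {w | ∑' u, (w u : ℝ≥0∞) = 1 ∧ ∀ u, 0 < w u ↔ u ∈ L}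

theorem lowerSemicontinuous_tsum_weights :
    LowerSemicontinuous fun w : U → ℝ≥0 => ∑' u, (w u : ℝ≥0∞) :=
  lowerSemicontinuous_tsum fun u =>
    (ENNReal.continuous_coe.comp (continuous_apply u)).lowerSemicontinuous

theorem isGδ_validWeights [Countable U] (L : Set U) : IsGδ (validWeights L) := by
  obtain ⟨a, -, ha1, ha⟩ := exists_seq_strictMono_tendsto' (zero_lt_one (α := ℝ≥0∞))
  have hlsc := lowerSemicontinuous_tsum_weights (U := U)
  have hsum : IsGδ {w : U → ℝ≥0 | ∑' u, (w u : ℝ≥0∞) = 1} := by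
    have heq : {w : U → ℝ≥0 | ∑' u, (w u : ℝ≥0∞) = 1} =
        (fun w : U → ℝ≥0 => ∑' u, (w u : ℝ≥0∞)) ⁻¹' Iic 1 ∩
          ⋂ n, (fun w : U → ℝ≥0 => ∑' u, (w u : ℝ≥0∞)) ⁻¹' Ioi (a n) := by
      ext w
      simp only [mem_ofPred_eq, mem_inter_iff, mem_preimage, mem_Iic, mem_iInter, mem_Ioi]
      constructor
      · intro h
        rw [h]
        exact ⟨le_rfl, fun n => (ha1 n).2⟩
      · rintro ⟨h1, h2⟩
        exact le_antisymm h1 (le_of_tendsto' ha fun n => (h2 n).le)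
    rw [heq]
    exact (hlsc.isClosed_preimage 1).isGδ.inter
      (IsGδ.iInter fun n => (hlsc.isOpen_preimage (a n)).isGδ)
  have hsupp : IsGδ {w : U → ℝ≥0 | ∀ u, 0 < w u ↔ u ∈ L} := by
    rw [ofPred_forall]
    refine IsGδ.iInter fun u => ?_
    by_cases hu : u ∈ L
    · simp only [hu, iff_true]
      exact (isOpen_lt continuous_const (continuous_apply u)).isGδ
    · simp only [hu, iff_false, not_lt]
      exact (isClosed_le (continuous_apply u) continuous_const).isGδ
  exact hsum.inter hsupp

theorem nonempty_validWeights [Countable U] {L : Set U} (hL : L.Nonempty) :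
    (validWeights L).Nonempty := by
  classical
  obtain ⟨a, ha⟩ := hL
  obtain ⟨e, he, s, hs, hs1⟩ := NNReal.exists_pos_sum_of_countable one_ne_zero U
  set v : U → ℝ≥0 := L.indicator e with hv
  have hvs : ∑' u, (v u : ℝ≥0∞) ≠ ∞ := by
    rw [ENNReal.tsum_coe_ne_top_iff_summable]
    exact NNReal.summable_of_le (fun u => indicator_le_self _ _ u) hs.summable
  have hv0 : ∑' u, (v u : ℝ≥0∞) ≠ 0 := by
    intro h
    have := ENNReal.tsum_eq_zero.1 h a
    simp [hv, ha, (he a).ne'] at this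
  lift ∑' u, (v u : ℝ≥0∞) to ℝ≥0 using hvs with r hr
  have hr0 : r ≠ 0 := by simpa using hv0
  refine ⟨fun u => r⁻¹ * v u, ?_, fun u => ?_⟩
  · simp only [ENNReal.coe_mul, ENNReal.tsum_mul_left, ← hr]
    rw [← ENNReal.coe_mul, inv_mul_cancel₀ hr0, ENNReal.coe_one]
  · by_cases hu : u ∈ L
    · simp [hv, hu, he u, pos_iff_ne_zero.2 hr0]
    · simp [hv, hu]

/-- Every probability mass function with support `L` is a limit of probability mass functions
whose supports are sublanguages of `L`, provided that these sublanguages cover every finite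
subset of `L`. -/
theorem validWeights_subset_closure_iUnion {ι : Type*} {L : Set U} {K : ι → Set U}
    (hKL : ∀ j, K j ⊆ L) (hK : ∀ T : Finset U, (T : Set U) ⊆ L → ∃ j, (T : Set U) ⊆ K j) :
    validWeights L ⊆ closure (⋃ j, validWeights (K j)) := by
  classical
  intro w hw
  have hcov : ∀ T : Finset U, ∃ j, (T : Set U) ∩ L ⊆ K j := by
    intro T
    obtain ⟨j, hj⟩ := hK (T.filter (· ∈ L)) (by intro x; simp)
    exact ⟨j, fun x hx => hj (by simpa using hx)⟩
  choose j hj using hcov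
  have hwsum : Summable w := by
    rw [← ENNReal.tsum_coe_ne_top_iff_summable, hw.1]
    exact ENNReal.one_ne_top
  have hw1 : ∑' u, w u = 1 := by
    have := hw.1
    rw [← ENNReal.coe_tsum hwsum] at this
    exact_mod_cast this
  have hwL : ∀ u, u ∉ L → w u = 0 := fun u hu => by
    simpa using (hw.2 u).not.2 hu
  set v : Finset U → U → ℝ≥0 := fun T => (K (j T)).indicator w with hv
  have hvsum : ∀ T, Summable (v T) := fun T =>
    NNReal.summable_of_le (fun u => indicator_le_self _ _ u) hwsum
  set r : Finset U → ℝ≥0 := fun T => ∑' u, v T u with hr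
  have hr1 : Tendsto r atTop (𝓝 1) := by
    refine tendsto_of_tendsto_of_tendsto_of_le_of_le (hw1 ▸ hwsum.hasSum) tendsto_const_nhds
      (fun T => ?_) (fun T => ?_)
    · refine le_trans (Finset.sum_le_sum fun u hu => ?_) ((hvsum T).sum_le_tsum T (by simp))
      by_cases huL : u ∈ L
      · simp [hv, hj T ⟨hu, huL⟩]
      · simp [hwL u huL]
    · rw [← hw1]
      exact (hvsum T).tsum_le_tsum (fun u => indicator_le_self _ _ u) hwsum
  have hr0 : ∀ᶠ T in atTop, r T ≠ 0 := hr1.eventually_ne one_ne_zero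
  refine mem_closure_of_tendsto (f := fun T u => (r T)⁻¹ * v T u) (b := atTop) ?_ ?_
  · rw [tendsto_pi_nhds]
    intro u
    have hvu : Tendsto (fun T => v T u) atTop (𝓝 (w u)) := by
      refine tendsto_const_nhds.congr' ?_
      filter_upwards [eventually_ge_atTop ({u} : Finset U)] with T hT
      by_cases huL : u ∈ L
      · have : u ∈ K (j T) := hj T ⟨by simpa using hT, huL⟩
        simp [hv, this]
      · simp [hv, indicator_apply, hwL u huL]
    simpa using (hr1.inv₀ one_ne_zero).mul hvu
  · filter_upwards [hr0] with T hT
    refine mem_iUnion.2 ⟨j T, ?_, fun u => ?_⟩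
    · have hs : ∑' u, (v T u : ℝ≥0∞) = r T := (ENNReal.coe_tsum (hvsum T)).symm
      simp only [ENNReal.coe_mul, ENNReal.tsum_mul_left, hs]
      rw [← ENNReal.coe_mul, inv_mul_cancel₀ hT, ENNReal.coe_one]
    · by_cases hu : u ∈ K (j T)
      · simp [hv, hu, pos_iff_ne_zero.2 hT, (hw.2 u).2 (hKL _ hu)]
      · simp [hv, hu]

theorem validWeights_subset_closure_of_subset {K L : Set U} (hKL : K ⊆ L)
    (hL : (validWeights L).Nonempty) : validWeights K ⊆ closure (validWeights L) := by
  intro w hw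
  obtain ⟨v, hv⟩ := hL
  have hc : Continuous fun δ : ℝ≥0 => fun u => (1 - δ) * w u + δ * v u := by fun_prop
  have hlim : Tendsto (fun δ : ℝ≥0 => fun u => (1 - δ) * w u + δ * v u) (𝓝[>] 0) (𝓝 w) := by
    refine (hc.tendsto' 0 w ?_).mono_left nhdsWithin_le_nhds
    ext u
    simp
  refine mem_closure_of_tendsto hlim ?_
  filter_upwards [Ioo_mem_nhdsGT (zero_lt_one (α := ℝ≥0))] with δ hδ
  refine ⟨?_, fun u => ?_⟩
  · simp only [ENNReal.coe_add, ENNReal.coe_mul, ENNReal.tsum_add, ENNReal.tsum_mul_left,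
      hw.1, hv.1, mul_one]
    rw [← ENNReal.coe_add, tsub_add_cancel_of_le hδ.2.le, ENNReal.coe_one]
  · constructor
    · intro h
      by_contra hu
      have h1 : w u = 0 := by simpa using (hw.2 u).not.2 fun h => hu (hKL h)
      have h2 : v u = 0 := by simpa using (hv.2 u).not.2 hu
      simp [h1, h2] at h
    · intro hu
      exact add_pos_of_nonneg_of_pos zero_le (mul_pos hδ.1 ((hv.2 u).2 hu))

theorem exists_isValidFor_of_mem_validWeights [MeasurableSpace U] [MeasurableSingletonClass U]
    {L : Set U} {w : U → ℝ≥0} (hw : w ∈ validWeights L) :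
    ∃ D : Measure U, IsValidFor D L ∧ ∀ u, D {u} = w u := by
  let p : PMF U := ⟨fun u => w u, hw.1 ▸ ENNReal.summable.hasSum⟩
  have hp : ∀ u, p.toMeasure {u} = w u := fun u =>
    p.toMeasure_apply_singleton u (measurableSet_singleton u)
  exact ⟨p.toMeasure, ⟨inferInstance, fun u => by rw [hp u, ← hw.2 u, ENNReal.coe_pos]⟩, hp⟩

end Weights

section Guesses

variable {U : Type*} (A : List U → Finset ℕ) (C : ℕ → Set U)

/-- The samples of size `t` on which some guess of `A` equals `S`. -/
def hitSet (t : ℕ) (S : Set U) : Set (Fin t → U) :=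
  {x | ∃ i ∈ A (List.ofFn x), C i = S}

/-- The probability, for samples of size `t` drawn independently from `w`, that some guess of
`A` equals `S`. -/
noncomputable def hitProb (w : U → ℝ≥0) (t : ℕ) (S : Set U) : ℝ≥0∞ :=
  ∑' x : hitSet A C t S, ∏ j, (w (x.1 j) : ℝ≥0∞)

theorem lowerSemicontinuous_hitProb (t : ℕ) (S : Set U) :
    LowerSemicontinuous fun w => hitProb A C w t S := by
  refine lowerSemicontinuous_tsum fun x => Continuous.lowerSemicontinuous ?_
  simp only [← ENNReal.ofNNReal_finsetProd]
  exact ENNReal.continuous_coe.comp (by fun_prop)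

variable [Countable U] [MeasurableSpace U] [MeasurableSingletonClass U]

theorem measurableSet_hit (t : ℕ) (S : Set U) :
    MeasurableSet {x : ℕ → U | ∃ i ∈ A (prefixList x t), C i = S} := by
  have hm : Measurable fun (x : ℕ → U) (j : Fin t) => x j := by fun_prop
  exact hm (MeasurableSet.of_discrete (s := hitSet A C t S))

theorem measure_hit_eq_hitProb {w : U → ℝ≥0} {D : Measure U} {μ : Measure (ℕ → U)}
    (hD : ∀ u, D {u} = w u) (hμ : IsIIDProduct D μ) (t : ℕ) (S : Set U) :
    μ {x | ∃ i ∈ A (prefixList x t), C i = S} = hitProb A C w t S := by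
  have heq : {x : ℕ → U | ∃ i ∈ A (prefixList x t), C i = S} =
      ⋃ y : hitSet A C t S, {f : ℕ → U | ∀ j : Fin t, f j ∈ ({y.1 j} : Set U)} := by
    ext x
    simp only [mem_ofPred_eq, mem_iUnion, mem_singleton_iff]
    constructor
    · intro h
      exact ⟨⟨fun j => x j, h⟩, fun j => rfl⟩
    · rintro ⟨⟨y, hy⟩, hxy⟩
      obtain rfl : (fun j : Fin t => x j) = y := funext hxy
      exact hy
  rw [heq, measure_iUnion]
  · exact tsum_congr fun y => by
      rw [hμ.2 t fun j => {y.1 j}]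
      simp only [hD]
  · intro y z hyz
    refine Set.disjoint_left.2 fun f hy hz => hyz (Subtype.ext (funext fun j => ?_))
    exact (hy j).symm.trans (hz j)
  · intro y
    rw [ofPred_forall]
    exact MeasurableSet.iInter fun j => measurable_pi_apply _ (measurableSet_singleton _)

/-- The expected number of distinct languages guessed is at most the size of the list. -/
theorem sum_hitProb_le {k : ℕ} (hA : ∀ s, (A s).card ≤ k) {w : U → ℝ≥0} {D : Measure U}
    {μ : Measure (ℕ → U)} (hD : ∀ u, D {u} = w u) (hμ : IsIIDProduct D μ) (t : ℕ)
    (F : Finset (Set U)) : ∑ S ∈ F, hitProb A C w t S ≤ k := by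
  classical
  have := hμ.1
  have hle : ∀ x : ℕ → U, ∑ S ∈ F,
      {x : ℕ → U | ∃ i ∈ A (prefixList x t), C i = S}.indicator (1 : (ℕ → U) → ℝ≥0∞) x ≤ k := by
    intro x
    simp only [indicator_apply, mem_ofPred_eq, Pi.one_apply, Finset.sum_boole]
    have hsub : F.filter (fun S => ∃ i ∈ A (prefixList x t), C i = S) ⊆
        (A (prefixList x t)).image C := by
      intro S hS
      simpa using (Finset.mem_filter.1 hS).2
    exact_mod_cast (Finset.card_le_card hsub).trans (Finset.card_image_le.trans (hA _))
  calc ∑ S ∈ F, hitProb A C w t S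
      = ∑ S ∈ F, ∫⁻ x, {x : ℕ → U | ∃ i ∈ A (prefixList x t), C i = S}.indicator 1 x ∂μ := by
        refine Finset.sum_congr rfl fun S _ => ?_
        rw [lintegral_indicator_one (measurableSet_hit A C t S), measure_hit_eq_hitProb A C hD hμ]
    _ = ∫⁻ x, ∑ S ∈ F, {x : ℕ → U | ∃ i ∈ A (prefixList x t), C i = S}.indicator 1 x ∂μ :=
        (lintegral_finsetSum _ fun S _ =>
          measurable_one.indicator (measurableSet_hit A C t S)).symm
    _ ≤ ∫⁻ _, (k : ℝ≥0∞) ∂μ := lintegral_mono hle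
    _ = k := by simp

/-- If failures occur infinitely often with probability less than `a`, then the hitting
probability eventually exceeds `1 - a`. -/
theorem exists_forall_lt_hitProb {w : U → ℝ≥0} {D : Measure U} {μ : Measure (ℕ → U)}
    (hD : ∀ u, D {u} = w u) (hμ : IsIIDProduct D μ) {S : Set U} {a : ℝ≥0∞} (ha : a ≤ 1)
    (h : μ {x : ℕ → U | ∀ N : ℕ, ∃ t ≥ N, ∀ i ∈ A (prefixList x t), C i ≠ S} < a) :
    ∃ N, ∀ t ≥ N, 1 - a < hitProb A C w t S := by
  have := hμ.1
  set E : ℕ → Set (ℕ → U) := fun t => {x | ∃ i ∈ A (prefixList x t), C i = S} with hE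
  have hEm : ∀ t, MeasurableSet (E t) := fun t => measurableSet_hit A C t S
  set B : ℕ → Set (ℕ → U) := fun N => ⋂ t ≥ N, E t with hB
  have hcompl : {x : ℕ → U | ∀ N : ℕ, ∃ t ≥ N, ∀ i ∈ A (prefixList x t), C i ≠ S} =
      (⋃ N, B N)ᶜ := by
    ext x
    simp [hB, hE]
  have hBm : MeasurableSet (⋃ N, B N) :=
    MeasurableSet.iUnion fun N => MeasurableSet.biInter (to_countable _) fun t _ => hEm t
  have hmono : Monotone B := fun M N hMN =>
    biInter_subset_biInter_left fun t (ht : N ≤ t) => hMN.trans ht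
  have hlt : 1 - a < μ (⋃ N, B N) := by
    rw [hcompl, prob_compl_eq_one_sub hBm] at h
    have h1 : 1 ≤ a + μ (⋃ N, B N) := tsub_le_iff_right.1 h.le
    refine lt_of_le_of_ne (tsub_le_iff_left.2 h1) fun heq => h.ne ?_
    rw [← heq, ENNReal.sub_sub_cancel ENNReal.one_ne_top ha]
  obtain ⟨N, hN⟩ := ((tendsto_measure_iUnion_atTop hmono).eventually (lt_mem_nhds hlt)).exists
  refine ⟨N, fun t ht => hN.trans_le ?_⟩
  rw [← measure_hit_eq_hitProb A C hD hμ]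
  exact measure_mono (biInter_subset_of_mem ht)

end Guesses

section Density

variable {U : Type*} (A : List U → Finset ℕ) (C : ℕ → Set U)

/-- The weights for which, at some time `t ≥ N`, some `m` languages satisfying `Q` are each hit
with probability larger than `p`. -/
def manyHits (p : ℝ≥0∞) (m N : ℕ) (Q : Set U → Prop) : Set (U → ℝ≥0) :=
  {w | ∃ t ≥ N, ∃ F : Finset (Set U), F.card = m ∧ ∀ S ∈ F, Q S ∧ p < hitProb A C w t S}

theorem isOpen_manyHits (p : ℝ≥0∞) (m N : ℕ) (Q : Set U → Prop) :
    IsOpen (manyHits A C p m N Q) := by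
  have heq : manyHits A C p m N Q = ⋃ t ≥ N, ⋃ F : {F : Finset (Set U) // F.card = m ∧ ∀ S ∈ F, Q S},
      ⋂ S ∈ F.1, {w | p < hitProb A C w t S} := by
    ext w
    simp only [manyHits, mem_ofPred_eq, mem_iUnion, mem_iInter, exists_prop, Subtype.exists]
    exact exists_congr fun t => and_congr_right fun _ => exists_congr fun F => by grind
  rw [heq]
  exact isOpen_biUnion fun t _ => isOpen_iUnion fun F => isOpen_biInter_finset fun S _ =>
    (lowerSemicontinuous_hitProb A C t S).isOpen_preimage p

theorem exists_of_not_Psi_succ {m : ℕ} {L : Set U} (h : ¬ Psi C (m + 1) L) (T : Finset U)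
    (hT : (T : Set U) ⊆ L) : ∃ j, C j ⊂ L ∧ (T : Set U) ⊆ C j ∧ (m = 0 ∨ ¬ Psi C m (C j)) := by
  cases m with
  | zero =>
    simp only [Psi, not_exists, not_and, not_forall, not_not] at h
    obtain ⟨j, hj, hTj⟩ := h T hT
    exact ⟨j, hj, hTj, Or.inl rfl⟩
  | succ m =>
    simp only [Psi, not_exists, not_and, not_forall, not_or, not_not] at h
    obtain ⟨j, hj, hTj, hP⟩ := h T hT
    exact ⟨j, hj, hTj, Or.inr hP⟩

/-- Density of the distributions with many simultaneous hits passes from a family of proper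
sublanguages covering every finite subset of `L` to `L` itself. -/
theorem validWeights_subset_closure_manyHits_ssubset {p : ℝ≥0∞} {m N : ℕ} {L : Set U} {J : Set ℕ}
    (hJ : ∀ j ∈ J, C j ⊂ L)
    (hcov : ∀ T : Finset U, (T : Set U) ⊆ L → ∃ j ∈ J, (T : Set U) ⊆ C j)
    (hdense : ∀ j ∈ J,
      validWeights (C j) ⊆ closure (validWeights (C j) ∩ manyHits A C p m N (· ⊆ C j))) :
    validWeights L ⊆ closure (validWeights L ∩ manyHits A C p m N (· ⊂ L)) := by
  intro w hw
  have hw' : w ∈ closure (⋃ j : J, validWeights (C j)) :=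
    validWeights_subset_closure_iUnion (K := fun j : J => C j) (fun j => (hJ j j.2).subset)
      (fun T hT => by simpa using hcov T hT) hw
  refine closure_minimal (iUnion_subset fun j => ?_) isClosed_closure hw'
  refine (hdense j j.2).trans (closure_minimal ?_ isClosed_closure)
  rintro v ⟨hv, t, ht, F, hF, hFS⟩
  refine (isOpen_manyHits A C p m N (· ⊂ L)).closure_inter
    ⟨validWeights_subset_closure_of_subset (hJ j j.2).subset ⟨w, hw⟩ hv, t, ht, F, hF, ?_⟩
  exact fun S hS => ⟨(hFS S hS).1.trans_ssubset (hJ j j.2), (hFS S hS).2⟩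

/-- Suppose that every language is eventually hit with probability larger than `p`, under every
distribution valid for it. Then the failure of `Psi C m` at `C z` makes the distributions hitting
`m + 1` sublanguages simultaneously dense among those valid for `C z`. -/
theorem validWeights_subset_closure_manyHits [Countable U] {p : ℝ≥0∞}
    (hp : ∀ z, ∀ w ∈ validWeights (C z), ∃ N, ∀ t ≥ N, p < hitProb A C w t (C z)) (m : ℕ) :
    ∀ z, (m = 0 ∨ ¬ Psi C m (C z)) → ∀ N,
      validWeights (C z) ⊆ closure (validWeights (C z) ∩ manyHits A C p (m + 1) N (· ⊆ C z)) := by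
  classical
  induction m with
  | zero =>
    intro z _ N w hw
    obtain ⟨M, hM⟩ := hp z w hw
    exact subset_closure ⟨hw, max M N, le_max_right _ _, {C z}, by simp,
      by simpa using hM _ (le_max_left _ _)⟩
  | succ m ih =>
    intro z hz N
    have hz' : ¬ Psi C (m + 1) (C z) := hz.resolve_left (Nat.succ_ne_zero m)
    have hproper : ∀ n, validWeights (C z) ⊆
        closure (validWeights (C z) ∩ manyHits A C p (m + 1) n (· ⊂ C z)) := fun n =>
      validWeights_subset_closure_manyHits_ssubset A C
        (J := {j | C j ⊂ C z ∧ (m = 0 ∨ ¬ Psi C m (C j))}) (fun j hj => hj.1)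
        (fun T hT => by
          obtain ⟨j, hj, hTj, hP⟩ := exists_of_not_Psi_succ C hz' T hT
          exact ⟨j, ⟨hj, hP⟩, hTj⟩)
        (fun j hj => ih j hj.2 n)
    refine ((isGδ_validWeights (C z)).subset_closure_inter_iInter
      (fun n => isOpen_manyHits A C p (m + 1) n _) hproper).trans (closure_mono ?_)
    rintro w ⟨hw, hwN⟩
    obtain ⟨M, hM⟩ := hp z w hw
    obtain ⟨t, ht, F, hF, hFS⟩ := mem_iInter.1 hwN (max M N)
    have hnot : C z ∉ F := fun h => ssubset_irrefl _ (hFS _ h).1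
    refine ⟨hw, t, (le_max_right _ _).trans ht, insert (C z) F, ?_, fun S hS => ?_⟩
    · rw [Finset.card_insert_of_notMem hnot, hF]
    · rcases Finset.mem_insert.1 hS with rfl | hS
      · exact ⟨subset_rfl, hM t ((le_max_left _ _).trans ht)⟩
      · exact ⟨(hFS S hS).1.subset, (hFS S hS).2⟩

end Density

/-- If `C` does not satisfy the `k`-Angluin condition, then for every
deterministic `k`-list identifier `A` there are an index `z` and a distribution `D` valid
for `C z` such that, with probability at least `1/(k+1)` under an infinite i.i.d. draw from
`D`, there are infinitely many times `t` at which no guess in `A(x_1, …, x_t)` equals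
`C z`. -/
theorem no_angluin_implies_constant_failure {U : Type*} [Countable U] [MeasurableSpace U]
    [MeasurableSingletonClass U]
    (C : ℕ → Set U) (hC : ∀ i, (C i).Nonempty) (k : ℕ) (hk : 1 ≤ k)
    (h : ¬ AngluinCondition C k) :
    ∀ A : List U → Finset ℕ, (∀ s, (A s).card ≤ k) →
      ∃ z : ℕ, ∃ D : Measure U, IsValidFor D (C z) ∧
        ∀ μ : Measure (ℕ → U), IsIIDProduct D μ →
          ((k : ENNReal) + 1)⁻¹ ≤
            μ {x : ℕ → U | ∀ N : ℕ, ∃ t ≥ N, ∀ i ∈ A (prefixList x t), C i ≠ C z} := by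
  intro A hA
  by_contra! hcon
  have ha : ((k : ENNReal) + 1)⁻¹ ≤ 1 := by simp
  have hp : ∀ z, ∀ w ∈ validWeights (C z),
      ∃ N, ∀ t ≥ N, 1 - ((k : ENNReal) + 1)⁻¹ < hitProb A C w t (C z) := by
    intro z w hw
    obtain ⟨D, hDv, hD⟩ := exists_isValidFor_of_mem_validWeights hw
    obtain ⟨μ, hμ, hlt⟩ := hcon z D hDv
    exact exists_forall_lt_hitProb A C hD hμ ha hlt
  obtain ⟨z, hz⟩ : ∃ z, ¬ Psi C k (C z) := by simpa [AngluinCondition] using h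
  obtain ⟨w₀, hw₀⟩ := nonempty_validWeights (hC z)
  obtain ⟨w, hw, t, -, F, hF, hFS⟩ := closure_nonempty_iff.1
    ⟨w₀, validWeights_subset_closure_manyHits A C hp k z (Or.inr hz) 0 hw₀⟩
  obtain ⟨D, hDv, hD⟩ := exists_isValidFor_of_mem_validWeights hw
  obtain ⟨μ, hμ, -⟩ := hcon z D hDv
  have hlt : ∑ S ∈ F, (1 - ((k : ENNReal) + 1)⁻¹) < ∑ S ∈ F, hitProb A C w t S :=
    ENNReal.sum_lt_sum_of_nonempty (Finset.card_pos.1 (hF ▸ Nat.succ_pos k))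
      fun S hS => (hFS S hS).2
  refine (hlt.trans_le (sum_hitProb_le A C hA hD hμ t F)).ne ?_
  rw [Finset.sum_const, hF, nsmul_eq_mul, ENNReal.mul_sub (by simp)]
  push_cast
  rw [ENNReal.mul_inv_cancel (by simp) (by finiteness), mul_one,
    ENNReal.add_sub_cancel_right ENNReal.one_ne_top]
end

section
/- Let U be a countable set, let C : ℕ → Set U be a language collection with every C i nonempty, and let k ≥ 1. Suppose C does not satisfy the k-Angluin condition. Then for every k-list identifier A there exist an index z and a probability distribution D valid for C z such that limsup_{t→∞} Pr_{(x_1,…,x_t) ~ D^t}[no i ∈ A(x_1, …, x_t) satisfies C i = C z] ≥ 1/(k+1). -/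
open MeasureTheory

open Filter Topology
open scoped ENNReal

/-- The probability mass functions on `U` vanishing outside `L`, as elements of `ℓ¹`. -/
def simplexOn {U : Type*} (L : Set U) : Set (lp (fun _ : U => ℝ) 1) :=
  {p | (∀ u, 0 ≤ p u) ∧ (∀ u, u ∉ L → p u = 0) ∧ ‖p‖ = 1}

/-- The expectation of `g (x₁, …, x_t)` when the `x_j` are drawn independently with
probability mass function `p`. -/
noncomputable def iidExpectation {U : Type*} (p : U → ℝ) (t : ℕ) (g : List U → ℕ) : ℝ≥0∞ :=
  ∑' f : Fin t → U, (g (List.ofFn f) : ℝ≥0∞) * ENNReal.ofReal (∏ j, p (f j))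

open scoped Classical in
/-- The number of languages of `S` which are listed by `A` on input `s`. -/
noncomputable def listedCount {U : Type*} (C : ℕ → Set U) (A : List U → Finset ℕ)
    (S : Finset (Set U)) (s : List U) : ℕ :=
  (S.filter fun M => ∃ i ∈ A s, C i = M).card

section Simplex

variable {U : Type*}

theorem continuous_lp_one_apply (u : U) :
    Continuous fun p : lp (fun _ : U => ℝ) 1 => p u :=
  (continuous_apply u).comp lp.uniformContinuous_coe.continuous

theorem lp_one_smul_add_smul_apply (a b : ℝ) (p q : lp (fun _ : U => ℝ) 1) (u : U) :
    (a • p + b • q : lp (fun _ : U => ℝ) 1) u = a * p u + b * q u :=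
  rfl

theorem isClosed_simplexOn (L : Set U) : IsClosed (simplexOn L) := by
  have h : simplexOn L = (⋂ u, {p : lp (fun _ : U => ℝ) 1 | 0 ≤ p u}) ∩
      ((⋂ u, ⋂ (_ : u ∉ L), {p : lp (fun _ : U => ℝ) 1 | p u = 0}) ∩ {p | ‖p‖ = 1}) := by
    ext p
    simp [simplexOn]
  rw [h]
  refine (isClosed_iInter fun u => isClosed_le continuous_const (continuous_lp_one_apply u)).inter
    ((isClosed_iInter fun u => isClosed_iInter fun _ =>
      isClosed_singleton.preimage (continuous_lp_one_apply u)).inter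
        (isClosed_eq continuous_norm continuous_const))

theorem hasSum_of_mem_simplexOn {L : Set U} {p : lp (fun _ : U => ℝ) 1} (hp : p ∈ simplexOn L) :
    HasSum (fun u => p u) 1 := by
  have h := lp.hasSum_norm (by simp) p
  simpa [hp.2.2, abs_of_nonneg (hp.1 _)] using h

theorem mem_simplexOn_of_hasSum {L : Set U} {p : lp (fun _ : U => ℝ) 1} (h0 : ∀ u, 0 ≤ p u)
    (hL : ∀ u, u ∉ L → p u = 0) (hs : HasSum (fun u => p u) 1) : p ∈ simplexOn L := by
  refine ⟨h0, hL, ?_⟩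
  have h := lp.hasSum_norm (by simp) p
  simp only [ENNReal.toReal_one, Real.rpow_one, Real.norm_eq_abs, abs_of_nonneg (h0 _)] at h
  exact h.unique hs

theorem simplexOn_mono {L M : Set U} (h : L ⊆ M) : simplexOn L ⊆ simplexOn M :=
  fun _ hp => ⟨hp.1, fun u hu => hp.2.1 u fun hL => hu (h hL), hp.2.2⟩

theorem convex_simplexOn (L : Set U) : Convex ℝ (simplexOn L) := by
  intro p hp q hq a b ha hb hab
  refine mem_simplexOn_of_hasSum (fun u => ?_) (fun u hu => ?_) ?_
  · rw [lp_one_smul_add_smul_apply]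
    exact add_nonneg (mul_nonneg ha (hp.1 u)) (mul_nonneg hb (hq.1 u))
  · rw [lp_one_smul_add_smul_apply, hp.2.1 u hu, hq.2.1 u hu]
    simp
  · have := ((hasSum_of_mem_simplexOn hp).mul_left a).add
      ((hasSum_of_mem_simplexOn hq).mul_left b)
    rwa [mul_one, mul_one, hab] at this

open scoped Classical in
theorem single_mem_simplexOn {L : Set U} {u : U} (hu : u ∈ L) :
    (lp.single 1 u (1 : ℝ) : lp (fun _ : U => ℝ) 1) ∈ simplexOn L := by
  refine ⟨fun v => ?_, fun v hv => ?_, ?_⟩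
  · rw [lp.single_apply, Pi.single_apply]
    split_ifs <;> norm_num
  · exact lp.single_apply_ne _ _ _ fun h => hv (h ▸ hu)
  · rw [lp.norm_single one_pos, norm_one]

theorem dense_setOf_apply_pos {L : Set U} {u : U} (hu : u ∈ L) :
    Dense {p : simplexOn L | 0 < (p : lp (fun _ : U => ℝ) 1) u} := by
  classical
  rw [dense_iff_inter_open]
  rintro _ ⟨O, hO, rfl⟩ ⟨⟨p, hp⟩, hpO⟩
  set e : lp (fun _ : U => ℝ) 1 := lp.single 1 u (1 : ℝ)
  have hcont : Tendsto (fun s : ℝ => (1 - s) • p + s • e) (𝓝[>] 0) (𝓝 p) := by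
    have h : Continuous fun s : ℝ => (1 - s) • p + s • e := by fun_prop
    simpa using (h.tendsto 0).mono_left nhdsWithin_le_nhds
  have hlt : ∀ᶠ s : ℝ in 𝓝[>] 0, s < 1 :=
    nhdsWithin_le_nhds (eventually_lt_nhds one_pos)
  obtain ⟨s, ⟨hsO, hs1⟩, hs0⟩ :=
    (((hcont.eventually (hO.mem_nhds hpO)).and hlt).and self_mem_nhdsWithin).exists
  have hs0 : 0 < s := hs0
  refine ⟨⟨(1 - s) • p + s • e, convex_simplexOn L hp (single_mem_simplexOn hu) (by linarith)
    hs0.le (by ring)⟩, hsO, ?_⟩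
  have h1 : 0 ≤ (1 - s) * p u := mul_nonneg (by linarith) (hp.1 u)
  have h2 : e u = 1 := lp.single_apply_self _ _ _
  rw [Set.mem_ofPred_eq, lp_one_smul_add_smul_apply, h2]
  linarith

/-- Finitely supported probability mass functions are dense among all of them. -/
theorem exists_finset_inter_simplexOn_nonempty {L : Set U} {O : Set (lp (fun _ : U => ℝ) 1)}
    (hO : IsOpen O) (hne : (O ∩ simplexOn L).Nonempty) :
    ∃ T : Finset U, (T : Set U) ⊆ L ∧ (O ∩ simplexOn (T : Set U)).Nonempty := by
  classical
  obtain ⟨p, hpO, hp⟩ := hne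
  have hsum : Tendsto (fun F : Finset U => ∑ i ∈ F, (lp.single 1 i (p i) :
      lp (fun _ : U => ℝ) 1)) atTop (𝓝 p) := lp.hasSum_single ENNReal.one_ne_top p
  have hnorm := hsum.norm
  rw [hp.2.2] at hnorm
  have hlim := (hnorm.inv₀ one_ne_zero).smul hsum
  rw [inv_one, one_smul] at hlim
  obtain ⟨F, hFO, hF0⟩ := ((hlim.eventually (hO.mem_nhds hpO)).and
    (hnorm.eventually (lt_mem_nhds one_pos))).exists
  set q : lp (fun _ : U => ℝ) 1 := ∑ i ∈ F, lp.single 1 i (p i)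
  have hq : ∀ u, q u = if u ∈ F then p u else 0 := by
    intro u
    have h : q u = ∑ i ∈ F, (lp.single 1 i (p i) : lp (fun _ : U => ℝ) 1) u :=
      (congrFun (lp.coeFn_sum _ F) u).trans (Finset.sum_apply u F _)
    simp [h, lp.single_apply, Pi.single_apply]
  refine ⟨F.filter (· ∈ L), by intro u; simp, ‖q‖⁻¹ • q, hFO, fun u => ?_, fun u hu => ?_, ?_⟩
  · have : 0 ≤ q u := by
      rw [hq]
      split_ifs
      exacts [hp.1 u, le_rfl]
    simp only [lp.coeFn_smul, Pi.smul_apply, smul_eq_mul]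
    positivity
  · have : q u = 0 := by
      rw [hq]
      split_ifs with h
      · exact hp.2.1 u fun hL => hu (by simp [h, hL])
      · rfl
    simp [this]
  · rw [norm_smul, norm_inv, norm_norm, inv_mul_cancel₀ hF0.ne']

end Simplex

section Expectation

variable {U : Type*}

theorem lowerSemicontinuous_iidExpectation (t : ℕ) (g : List U → ℕ) :
    LowerSemicontinuous fun p : lp (fun _ : U => ℝ) 1 => iidExpectation p t g := by
  refine lowerSemicontinuous_tsum fun f => Continuous.lowerSemicontinuous ?_
  refine (ENNReal.continuous_const_mul (ENNReal.natCast_ne_top _)).comp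
    (ENNReal.continuous_ofReal.comp ?_)
  exact continuous_finsetProd _ fun j _ => continuous_lp_one_apply (f j)

theorem iidExpectation_add (p : U → ℝ) (t : ℕ) (g h : List U → ℕ) :
    iidExpectation p t (fun s => g s + h s) = iidExpectation p t g + iidExpectation p t h := by
  simp only [iidExpectation, Nat.cast_add, add_mul, ENNReal.tsum_add]

theorem iidExpectation_mono (p : U → ℝ) (t : ℕ) {g h : List U → ℕ} (hgh : ∀ s, g s ≤ h s) :
    iidExpectation p t g ≤ iidExpectation p t h :=
  ENNReal.tsum_le_tsum fun f => by gcongr; exact hgh _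

theorem iidExpectation_const (p : U → ℝ) (t n : ℕ) :
    iidExpectation p t (fun _ => n) = n * iidExpectation p t (fun _ => 1) := by
  simp only [iidExpectation, ENNReal.tsum_mul_left, Nat.cast_one, one_mul]

theorem iidExpectation_one {p : U → ℝ} (hp : ∀ u, 0 ≤ p u) (hs : HasSum p 1) (t : ℕ) :
    iidExpectation p t (fun _ => 1) = 1 := by
  induction t with
  | zero => simp [iidExpectation]
  | succ t ih =>
    simp only [iidExpectation, Nat.cast_one, one_mul] at ih ⊢
    rw [← (Fin.consEquiv fun _ => U).tsum_eq, ENNReal.tsum_prod']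
    simp only [Fin.consEquiv_apply, Fin.prod_univ_succ, Fin.cons_zero, Fin.cons_succ,
      ENNReal.ofReal_mul (hp _), ENNReal.tsum_mul_left, ih, mul_one]
    rw [← ENNReal.ofReal_tsum_of_nonneg hp hs.summable, hs.tsum_eq, ENNReal.ofReal_one]

theorem listedCount_le (C : ℕ → Set U) (A : List U → Finset ℕ) (S : Finset (Set U))
    (s : List U) : listedCount C A S s ≤ (A s).card := by
  refine (Finset.card_le_card (t := (A s).image C) fun M hM => ?_).trans Finset.card_image_le
  simpa using (Finset.mem_filter.1 hM).2

open scoped Classical in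
theorem listedCount_insert (C : ℕ → Set U) (A : List U → Finset ℕ) {S : Finset (Set U)}
    {L : Set U} (hL : L ∉ S) (s : List U) :
    listedCount C A (insert L S) s =
      (if ∃ i ∈ A s, C i = L then 1 else 0) + listedCount C A S s := by
  rw [listedCount, listedCount, Finset.filter_insert]
  split_ifs
  · rw [Finset.card_insert_of_notMem (by simp [hL]), add_comm]
  · rw [zero_add]

open scoped Classical in
theorem listedCount_singleton (C : ℕ → Set U) (A : List U → Finset ℕ) (L : Set U) (s : List U) :
    listedCount C A {L} s = if ∃ i ∈ A s, C i = L then 1 else 0 := by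
  rw [listedCount, Finset.filter_singleton]
  split_ifs <;> simp

end Expectation

section Measure

variable {U : Type*} [MeasurableSpace U] [MeasurableSingletonClass U]

theorem exists_isValidFor {L : Set U} {p : lp (fun _ : U => ℝ) 1} (hp : p ∈ simplexOn L)
    (hpos : ∀ u ∈ L, 0 < p u) :
    ∃ D : Measure U, IsValidFor D L ∧ ∀ u, D {u} = ENNReal.ofReal (p u) := by
  have hs := hasSum_of_mem_simplexOn hp
  have h1 : ∑' u, ENNReal.ofReal (p u) = 1 := by
    rw [← ENNReal.ofReal_tsum_of_nonneg hp.1 hs.summable, hs.tsum_eq, ENNReal.ofReal_one]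
  let P : PMF U := ⟨fun u => ENNReal.ofReal (p u), ENNReal.summable.hasSum_iff.2 h1⟩
  have hD : ∀ u, P.toMeasure {u} = ENNReal.ofReal (p u) := fun u =>
    P.toMeasure_apply_singleton u (measurableSet_singleton u)
  refine ⟨P.toMeasure, ⟨inferInstance, fun u => ?_⟩, hD⟩
  rw [hD, ENNReal.ofReal_pos]
  refine ⟨fun h => ?_, hpos u⟩
  by_contra hu
  exact h.ne' (hp.2.1 u hu)

open scoped Classical in
theorem iidProduct_prefixList_apply [Countable U] {p : U → ℝ} (hp : ∀ u, 0 ≤ p u) {D : Measure U}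
    (hD : ∀ u, D {u} = ENNReal.ofReal (p u)) {μ : Measure (ℕ → U)} (hμ : IsIIDProduct D μ)
    (t : ℕ) (E : List U → Prop) :
    μ {x | E (prefixList x t)} = iidExpectation p t fun s => if E s then 1 else 0 := by
  have hr : Measurable fun (x : ℕ → U) (j : Fin t) => x j := by fun_prop
  have hE : MeasurableSet {f : Fin t → U | E (List.ofFn f)} := Set.Countable.measurableSet
    (Set.to_countable _)
  have h := Measure.tsum_indicator_apply_singleton (μ.map fun x (j : Fin t) => x j) _ hE
  rw [Measure.map_apply hr hE] at h
  change _ = μ {x | E (prefixList x t)} at h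
  rw [← h]
  refine tsum_congr fun f => ?_
  have hf : μ.map (fun x (j : Fin t) => x j) {f} = ENNReal.ofReal (∏ j, p (f j)) := by
    rw [Measure.map_apply hr (measurableSet_singleton f),
      ENNReal.ofReal_prod_of_nonneg fun j _ => hp (f j)]
    simp only [← hD]
    rw [← hμ.2 t fun j => {f j}]
    congr 1
    ext x
    simp [funext_iff]
  by_cases hEf : E (List.ofFn f) <;> simp [Set.indicator, hEf, hf]

open scoped Classical in
theorem lt_iidExpectation_listedCount_singleton [Countable U] {p : U → ℝ} (hp : ∀ u, 0 ≤ p u)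
    (hs : HasSum p 1) {D : Measure U}
    (hD : ∀ u, D {u} = ENNReal.ofReal (p u)) {μ : Measure (ℕ → U)} (hμ : IsIIDProduct D μ)
    {t : ℕ} {C : ℕ → Set U} {A : List U → Finset ℕ} {L : Set U} {ε : ℝ≥0∞} (hε : ε ≤ 1)
    (h : μ {x | ∀ i ∈ A (prefixList x t), C i ≠ L} < ε) :
    1 - ε < iidExpectation p t (listedCount C A {L}) := by
  rw [funext (listedCount_singleton C A L)]
  rw [iidProduct_prefixList_apply hp hD hμ t fun s => ∀ i ∈ A s, C i ≠ L] at h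
  have hsum := iidExpectation_add p t (fun s => if ∃ i ∈ A s, C i = L then 1 else 0)
    fun s => if ∀ i ∈ A s, C i ≠ L then 1 else 0
  have hone : (fun s => (if ∃ i ∈ A s, C i = L then 1 else 0) +
      if ∀ i ∈ A s, C i ≠ L then 1 else 0) = fun _ => 1 := by
    funext s
    by_cases hs : ∃ i ∈ A s, C i = L
    · have : ¬ ∀ i ∈ A s, C i ≠ L := by simpa using hs
      rw [if_pos hs, if_neg this]
    · have : ∀ i ∈ A s, C i ≠ L := by simpa using hs
      rw [if_neg hs, if_pos this]
  rw [hone, iidExpectation_one hp hs t] at hsum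
  refine ENNReal.sub_lt_of_lt_add hε ?_
  rw [hsum]
  exact ENNReal.add_lt_add_left
    (ne_top_of_le_ne_top ENNReal.one_ne_top (le_self_add.trans_eq hsum.symm))
    (by convert h)

end Measure

theorem exists_ssubset_of_not_psi {U : Type*} {C : ℕ → Set U} {m : ℕ} {L : Set U}
    (h : ¬ Psi C (m + 1) L) {T : Finset U} (hT : (T : Set U) ⊆ L) :
    ∃ j, C j ⊂ L ∧ (T : Set U) ⊆ C j ∧ (m = 0 ∨ ¬ Psi C m (C j)) := by
  cases m with
  | zero =>
    simp only [Psi, not_exists, not_and, not_forall, not_not] at h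
    obtain ⟨j, hj, hTj⟩ := h T hT
    exact ⟨j, hj, hTj, Or.inl rfl⟩
  | succ m =>
    simp only [Psi, not_exists, not_and, not_forall, not_or, not_not] at h
    obtain ⟨j, hj, hTj, hP⟩ := h T hT
    exact ⟨j, hj, hTj, Or.inr hP⟩

theorem eventually_residual_forall_apply_pos {U : Type*} [Countable U] (L : Set U) :
    ∀ᶠ p : simplexOn L in residual _, ∀ u ∈ L, 0 < (p : lp (fun _ : U => ℝ) 1) u := by
  have h : ∀ᶠ p : simplexOn L in residual _, ∀ u : L, 0 < (p : lp (fun _ : U => ℝ) 1) u := by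
    rw [eventually_countable_forall]
    exact fun u => residual_of_dense_open (isOpen_lt continuous_const
      ((continuous_lp_one_apply (u : U)).comp continuous_subtype_val))
        (dense_setOf_apply_pos u.2)
  exact h.mono fun p hp u hu => hp ⟨u, hu⟩

/-- If, for every fully supported distribution on a language, that language is eventually listed
with probability more than `r`, then near every distribution on a language violating the `m`-th
Angluin predicate there is one for which, at some late time, more than `(m + 1) * r` out of
`m + 1` languages are listed on average. -/
theorem exists_lt_iidExpectation_listedCount {U : Type*} [Countable U] {C : ℕ → Set U}
    {A : List U → Finset ℕ} {r : ℝ≥0∞}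
    (hA : ∀ i, ∀ p ∈ simplexOn (C i), (∀ u ∈ C i, 0 < p u) →
      ∀ᶠ t in atTop, r < iidExpectation p t (listedCount C A {C i}))
    (m i : ℕ) (hm : m = 0 ∨ ¬ Psi C m (C i)) {O : Set (lp (fun _ : U => ℝ) 1)} (hO : IsOpen O)
    (hne : (O ∩ simplexOn (C i)).Nonempty) (n : ℕ) :
    ∃ p ∈ O ∩ simplexOn (C i), ∃ t ≥ n, ∃ S : Finset (Set U), S.card = m + 1 ∧
      (∀ M ∈ S, M ⊆ C i) ∧ (m + 1) * r < iidExpectation p t (listedCount C A S) := by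
  classical
  induction m generalizing i O n with
  | zero =>
    have := (isClosed_simplexOn (C i)).completeSpace_coe
    obtain ⟨p₀, hp₀O, hp₀⟩ := hne
    obtain ⟨p, hpO, hpos⟩ := (dense_of_mem_residual
      (eventually_residual_forall_apply_pos (C i))).inter_open_nonempty _
        (hO.preimage continuous_subtype_val) ⟨⟨p₀, hp₀⟩, hp₀O⟩
    obtain ⟨t, ht, htn⟩ := ((hA i p p.2 hpos).and (eventually_ge_atTop n)).exists
    exact ⟨p, ⟨hpO, p.2⟩, t, htn, {C i}, by simp, by simp, by simpa using ht⟩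
  | succ m ih =>
    have := (isClosed_simplexOn (C i)).completeSpace_coe
    have hm := hm.resolve_left (Nat.succ_ne_zero m)
    let W (n : ℕ) : Set (simplexOn (C i)) := {p | ∃ t ≥ n, ∃ S : Finset (Set U),
      S.card = m + 1 ∧ (∀ M ∈ S, M ⊂ C i) ∧
        (m + 1) * r < iidExpectation (p : lp (fun _ : U => ℝ) 1) t (listedCount C A S)}
    have hWopen : ∀ n, IsOpen (W n) := by
      refine fun n => isOpen_iff_mem_nhds.2 ?_
      rintro p ⟨t, ht, S, hS, hSC, hlt⟩
      filter_upwards [continuous_subtype_val.continuousAt.eventually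
        (lowerSemicontinuous_iidExpectation t (listedCount C A S) p _ hlt)] with q hq
      exact ⟨t, ht, S, hS, hSC, hq⟩
    have hWdense : ∀ n, Dense (W n) := by
      intro n
      rw [dense_iff_inter_open]
      rintro _ ⟨O', hO', rfl⟩ ⟨q, hq⟩
      obtain ⟨T, hT, q', hq'O, hq'⟩ :=
        exists_finset_inter_simplexOn_nonempty hO' ⟨q, hq, q.2⟩
      obtain ⟨j, hj, hTj, hPj⟩ := exists_ssubset_of_not_psi hm hT
      obtain ⟨p, ⟨hpO, hp⟩, t, ht, S, hS, hSC, hlt⟩ :=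
        ih j hPj hO' ⟨q', hq'O, simplexOn_mono hTj hq'⟩ n
      exact ⟨⟨p, simplexOn_mono hj.subset hp⟩, hpO, t, ht, S, hS,
        fun M hM => (hSC M hM).trans_ssubset hj, hlt⟩
    have hW : ∀ᶠ p in residual _, ∀ n, p ∈ W n :=
      eventually_countable_forall.2 fun n => residual_of_dense_open (hWopen n) (hWdense n)
    obtain ⟨p₀, hp₀O, hp₀⟩ := hne
    obtain ⟨p, hpO, hpos, hpW⟩ := (dense_of_mem_residual
      ((eventually_residual_forall_apply_pos (C i)).and hW)).inter_open_nonempty _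
        (hO.preimage continuous_subtype_val) ⟨⟨p₀, hp₀⟩, hp₀O⟩
    obtain ⟨N, hN⟩ := eventually_atTop.1 (hA i p p.2 hpos)
    obtain ⟨t, ht, S, hS, hSC, hlt⟩ := hpW (max n N)
    have hiS : C i ∉ S := fun h => (hSC _ h).ne rfl
    refine ⟨p, ⟨hpO, p.2⟩, t, (le_max_left _ _).trans ht, insert (C i) S, ?_, ?_, ?_⟩
    · rw [Finset.card_insert_of_notMem hiS, hS]
    · simpa using fun M hM => (hSC M hM).subset
    · have hcount : listedCount C A (insert (C i) S) =
          fun s => listedCount C A {C i} s + listedCount C A S s := by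
        funext s
        rw [listedCount_insert C A hiS, listedCount_singleton]
      rw [hcount, iidExpectation_add]
      calc ((m + 1 : ℕ) + 1 : ℝ≥0∞) * r = r + (m + 1) * r := by push_cast; ring
        _ < _ := ENNReal.add_lt_add (hN t ((le_max_right _ _).trans ht)) hlt

/-- If `C` does not satisfy the `k`-Angluin condition, then for every
`k`-list identifier `A` there are an index `z` and a distribution `D` valid for `C z` such
that the limsup over `t` of the probability (under `t` i.i.d. draws from `D`, expressed
via the infinite product measure) that no guess in `A(x_1, …, x_t)` equals `C z` is at
least `1/(k+1)`. -/
theorem no_angluin_implies_no_rate {U : Type*} [Countable U] [MeasurableSpace U]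
    [MeasurableSingletonClass U]
    (C : ℕ → Set U) (hC : ∀ i, (C i).Nonempty) (k : ℕ) (hk : 1 ≤ k)
    (h : ¬ AngluinCondition C k) :
    ∀ A : List U → Finset ℕ, (∀ s, (A s).card ≤ k) →
      ∃ z : ℕ, ∃ D : Measure U, IsValidFor D (C z) ∧
        ∀ μ : Measure (ℕ → U), IsIIDProduct D μ →
          ((k : ENNReal) + 1)⁻¹ ≤
            Filter.limsup
              (fun t : ℕ => μ {x : ℕ → U | ∀ i ∈ A (prefixList x t), C i ≠ C z})
              Filter.atTop := by
  intro A hcard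
  by_contra hcon
  push Not at hcon
  obtain ⟨i, hi⟩ := not_forall.1 h
  have hinv : ((k : ENNReal) + 1)⁻¹ ≤ 1 := ENNReal.inv_le_one.2 le_add_self
  have hA : ∀ i, ∀ p ∈ simplexOn (C i), (∀ u ∈ C i, 0 < p u) →
      ∀ᶠ t in atTop, 1 - ((k : ENNReal) + 1)⁻¹ < iidExpectation p t (listedCount C A {C i}) := by
    intro i p hp hpos
    obtain ⟨D, hDv, hD⟩ := exists_isValidFor hp hpos
    obtain ⟨μ, hμ, hlim⟩ := hcon i D hDv
    filter_upwards [eventually_lt_of_limsup_lt hlim] with t ht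
    exact lt_iidExpectation_listedCount_singleton hp.1 (hasSum_of_mem_simplexOn hp) hD hμ hinv ht
  obtain ⟨u, hu⟩ := hC i
  classical
  obtain ⟨p, ⟨-, hp⟩, t, -, S, -, -, hlt⟩ := exists_lt_iidExpectation_listedCount hA k i
    (Or.inr hi) isOpen_univ ⟨_, Set.mem_univ _, single_mem_simplexOn hu⟩ 0
  have hk1 : ((k : ENNReal) + 1) * (1 - ((k : ENNReal) + 1)⁻¹) = k := by
    rw [ENNReal.mul_sub (by simp), mul_one, ENNReal.mul_inv_cancel (by simp) (by simp),
      ENNReal.add_sub_cancel_right ENNReal.one_ne_top]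
  rw [hk1] at hlt
  refine hlt.not_ge ((iidExpectation_mono p t fun s =>
    (listedCount_le C A S s).trans (hcard s)).trans ?_)
  rw [iidExpectation_const, iidExpectation_one hp.1 (hasSum_of_mem_simplexOn hp), mul_one]
end
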